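/- arXiv:1607.04529 — 2 statements merged into one kernel-verified Lean document; each statement's English description precedes it below -/
import Mathlib

section
/- Let R be a Noetherian ring, 𝔞 ⊊ R a proper ideal, M a finite R-module, and n a positive integer such that Ext^j_R(R/𝔞, D_R(H^t_𝔞(M))) = 0 for all t > n and all j ≥ 0. Then Hom_R(R/𝔞, D_R(H^n_𝔞(M))) = 0. In particular this holds when n = cd(𝔞,M). -/
open CategoryTheory

noncomputable section

/-- The cohomological dimension `cd(𝔞, M)`: the supremum (in `ℕ`) of the set of
indices `i` with `H^i_𝔞(M) ≠ 0`, local cohomology being taken w.r.t. `𝔞`. -/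
def cohDim {R : Type} [CommRing R] (I : Ideal R) (M : Type) [AddCommGroup M] [Module R M] : ℕ :=
  sSup {i : ℕ | Nontrivial ((localCohomology I i).obj (ModuleCat.of R M))}

/-- `M` is relative Cohen-Macaulay w.r.t. `𝔞` if there is precisely one non-vanishing
local cohomology module of `M` w.r.t. `𝔞`. -/
def IsRelCM {R : Type} [CommRing R] (I : Ideal R) (M : Type) [AddCommGroup M] [Module R M] :
    Prop :=
  ∃ c : ℕ, ∀ i : ℕ, Nontrivial ((localCohomology I i).obj (ModuleCat.of R M)) ↔ i = c

/-- `f : K →ₗ[R] E` exhibits `E` as an injective hull of `K`: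
`E` is an injective module and `f` is an essential monomorphism. -/
structure IsInjectiveHull (R : Type) [CommRing R] {K E : Type} [AddCommGroup K] [Module R K]
    [AddCommGroup E] [Module R E] (f : K →ₗ[R] E) : Prop where
  injective : Module.Injective R E
  inj : Function.Injective f
  essential : ∀ N : Submodule R E, N ≠ ⊥ → N ⊓ LinearMap.range f ≠ ⊥

/-- `F` is the cohomological dimension filtration (cd-filtration) of `M` in the range
`0 ≤ i ≤ c`: `F i` is the largest submodule of `M` of cohomological dimension `≤ i`. -/
def IsCdFiltration {R : Type} [CommRing R] (I : Ideal R) {M : Type} [AddCommGroup M]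
    [Module R M] (c : ℕ) (F : ℕ → Submodule R M) : Prop :=
  ∀ i ≤ c, cohDim I (F i) ≤ i ∧ ∀ N : Submodule R M, cohDim I N ≤ i → N ≤ F i

/-- The `i`-th factor `M_i / M_{i-1}` of a filtration `F` of `M`. -/
def filtFactor {R : Type} [CommRing R] {M : Type} [AddCommGroup M] [Module R M]
    (F : ℕ → Submodule R M) (i : ℕ) : Type :=
  ↥(F i) ⧸ Submodule.comap (F i).subtype (F (i - 1))

instance {R : Type} [CommRing R] {M : Type} [AddCommGroup M] [Module R M]
    (F : ℕ → Submodule R M) (i : ℕ) : AddCommGroup (filtFactor F i) :=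
  inferInstanceAs (AddCommGroup (↥(F i) ⧸ Submodule.comap (F i).subtype (F (i - 1))))

instance {R : Type} [CommRing R] {M : Type} [AddCommGroup M] [Module R M]
    (F : ℕ → Submodule R M) (i : ℕ) : Module R (filtFactor F i) :=
  inferInstanceAs (Module R (↥(F i) ⧸ Submodule.comap (F i).subtype (F (i - 1))))

/-- `M` is a relative Cohen-Macaulay filtered (RCMF) module w.r.t. `𝔞`: every factor
`M_i/M_{i-1}` (`1 ≤ i ≤ c = cd(𝔞,M)`) of its cd-filtration is either zero or an
`i`-cohomological dimensional relative Cohen-Macaulay module w.r.t. `𝔞`. -/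
def IsRCMF {R : Type} [CommRing R] (I : Ideal R) (M : Type) [AddCommGroup M] [Module R M] :
    Prop :=
  ∀ F : ℕ → Submodule R M, IsCdFiltration I (cohDim I M) F →
    ∀ i : ℕ, 1 ≤ i → i ≤ cohDim I M →
      Subsingleton (filtFactor F i) ∨
        (IsRelCM I (filtFactor F i) ∧ cohDim I (filtFactor F i) = i)

end

open CategoryTheory

set_option linter.unusedSectionVars false
set_option linter.unusedSimpArgs false

namespace Kz

section Mat
variable {R : Type} [CommRing R] {S : Type} [Fintype S]

/-- The action of a matrix with entries in `R` on vectors with entries in a module. -/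
def mact (A : Matrix S S R) {X : Type} [AddCommGroup X] [Module R X] : (S → X) →ₗ[R] (S → X) where
  toFun c s := ∑ t, A s t • c t
  map_add' a b := by ext s; simp [Finset.sum_add_distrib]
  map_smul' r a := by ext s; simp [Finset.smul_sum, smul_comm r]

lemma mact_apply (A : Matrix S S R) {X : Type} [AddCommGroup X] [Module R X] (c : S → X) (s : S) :
    mact A c s = ∑ t, A s t • c t := rfl

lemma mact_mul (A B : Matrix S S R) {X : Type} [AddCommGroup X] [Module R X] (c : S → X) :
    mact (A * B) c = mact A (mact B c) := by
  ext s
  simp only [mact_apply, Matrix.mul_apply, Finset.sum_smul, Finset.smul_sum, mul_smul]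
  exact Finset.sum_comm

lemma mact_comp (A : Matrix S S R) {X Y : Type} [AddCommGroup X] [Module R X] [AddCommGroup Y]
    [Module R Y] (f : X →ₗ[R] Y) (c : S → X) :
    mact A (fun s => f (c s)) = fun s => f (mact A c s) := by
  ext s; simp [mact_apply]

/-- Vanishing of the homology in degree `j` of the complex given by `A`, with weights `w`. -/
def Van (A : Matrix S S R) (w : S → ℤ) (j : ℤ) (X : Type) [AddCommGroup X] [Module R X] : Prop :=
  ∀ c : S → X, (∀ s, w s ≠ j → c s = 0) → mact A c = 0 → ∃ b : S → X, mact A b = c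

open Classical in
/-- the degree `j` component -/
noncomputable def comp (w : S → ℤ) (j : ℤ) {X : Type} [AddCommGroup X] (c : S → X) : S → X :=
  fun s => if w s = j then c s else 0

def Homog (A : Matrix S S R) (w : S → ℤ) : Prop := ∀ s t, A s t ≠ 0 → w t = w s + 1

lemma Homog.transpose {A : Matrix S S R} {w : S → ℤ} (h : Homog A w) :
    Homog A.transpose (fun s => - w s) := by
  intro s t hst
  have := h t s hst
  dsimp only
  omega

lemma mact_comp_deg {A : Matrix S S R} {w : S → ℤ} (h : Homog A w) (j : ℤ)
    {X : Type} [AddCommGroup X] [Module R X] (c : S → X) :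
    mact A (comp w (j + 1) c) = comp w j (mact A c) := by
  classical
  ext s
  simp only [mact_apply, comp]
  split_ifs with hs
  · apply Finset.sum_congr rfl
    intro t _
    by_cases hA : A s t = 0
    · simp [hA]
    · rw [if_pos]; rw [h s t hA, hs]
  · apply Finset.sum_eq_zero
    intro t _
    by_cases hA : A s t = 0
    · simp [hA]
    · rw [if_neg]; simp
      have := h s t hA
      omega

lemma comp_eq_self {w : S → ℤ} {j : ℤ} {X : Type} [AddCommGroup X] {c : S → X}
    (hc : ∀ s, w s ≠ j → c s = 0) : comp w j c = c := by
  ext s; simp only [comp]; split_ifs with h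
  · rfl
  · exact (hc s h).symm

lemma comp_deg (w : S → ℤ) (j : ℤ) {X : Type} [AddCommGroup X] (c : S → X) :
    ∀ s, w s ≠ j → comp w j c s = 0 := by
  intro s hs; simp [comp, hs]

/-- the solution may be taken homogeneous -/
lemma Van.homog {A : Matrix S S R} {w : S → ℤ} (h : Homog A w) {j : ℤ} {X : Type}
    [AddCommGroup X] [Module R X] (hV : Van A w j X) (c : S → X) (hc : ∀ s, w s ≠ j → c s = 0)
    (hA : mact A c = 0) : ∃ b : S → X, (∀ s, w s ≠ j + 1 → b s = 0) ∧ mact A b = c := by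
  obtain ⟨b, hb⟩ := hV c hc hA
  refine ⟨comp w (j + 1) b, comp_deg _ _ _, ?_⟩
  rw [mact_comp_deg h, hb, comp_eq_self hc]

variable {A : Matrix S S R} {w : S → ℤ}
variable {X Y Z : Type} [AddCommGroup X] [Module R X] [AddCommGroup Y] [Module R Y]
  [AddCommGroup Z] [Module R Z]

lemma van_left (h : Homog A w) (hAA : A * A = 0) {j : ℤ} (f : X →ₗ[R] Y) (g : Y →ₗ[R] Z)
    (hf : Function.Injective f) (hg : Function.Surjective g)
    (hfg : Function.Exact f g) (hZ : Van A w (j + 1) Z) (hY : Van A w j Y) : Van A w j X := by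
  intro c hc hAc
  obtain ⟨b, hb, hbc⟩ := hY.homog h (fun s => f (c s)) (fun s hs => by simp [hc s hs])
    (by rw [mact_comp, hAc]; ext; simp)
  obtain ⟨e, he⟩ := hZ (fun s => g (b s)) (fun s hs => by simp [hb s hs])
    (by rw [mact_comp, hbc]; ext s; simp [hfg.apply_apply_eq_zero])
  choose e' he' using fun s => hg (e s)
  have key : ∀ s, ∃ a, f a = b s - mact A e' s := by
    intro s
    apply (hfg _).1
    rw [map_sub]
    have := congrFun (mact_comp A g e') s
    simp only [he'] at this
    rw [← this]
    have h2 := congrFun he s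
    rw [← h2]; simp
  choose a ha using key
  refine ⟨a, ?_⟩
  ext s
  apply hf
  rw [← congrFun (mact_comp A f a) s]
  have : (fun s => f (a s)) = b - mact A e' := by ext s; simp [ha]
  rw [this, map_sub, hbc, ← mact_mul, hAA]
  simp [mact_apply]

lemma van_mid (h : Homog A w) (hAA : A * A = 0) {j : ℤ} (f : X →ₗ[R] Y) (g : Y →ₗ[R] Z)
    (hf : Function.Injective f) (hg : Function.Surjective g)
    (hfg : Function.Exact f g) (hX : Van A w j X) (hZ : Van A w j Z) : Van A w j Y := by
  intro c hc hAc
  obtain ⟨e, hed, he⟩ := hZ.homog h (fun s => g (c s)) (fun s hs => by simp [hc s hs])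
    (by rw [mact_comp, hAc]; ext; simp)
  choose e'' he'' using fun s => hg (e s)
  let e' := comp w (j + 1) e''
  have he' : ∀ s, g (e' s) = e s := by
    intro s
    simp only [e', comp]
    split_ifs with hs
    · exact he'' s
    · simp [hed s hs]
  have key : ∀ s, ∃ a, f a = c s - mact A e' s := by
    intro s
    apply (hfg _).1
    rw [map_sub]
    have := congrFun (mact_comp A g e') s
    simp only [he'] at this
    rw [← this]
    have h2 := congrFun he s
    rw [← h2]; simp
  choose a ha using key
  have hfa : (fun s => f (a s)) = c - mact A e' := by ext s; simp [ha]
  obtain ⟨b, hb⟩ := hX a (by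
      intro s hs
      apply hf
      rw [ha, map_zero, hc s hs]
      have : mact A e' = comp w j (mact A e'') := mact_comp_deg h j e''
      rw [this, comp_deg _ _ _ s hs, sub_zero]) (by
      ext s
      apply hf
      rw [← congrFun (mact_comp A f a) s, hfa, map_sub, hAc, ← mact_mul, hAA]
      simp [mact_apply])
  refine ⟨(fun s => f (b s)) + e', ?_⟩
  rw [map_add, mact_comp, hb, hfa]
  simp

lemma van_iso (e : X ≃ₗ[R] Y) {j : ℤ} (hX : Van A w j X) : Van A w j Y := by
  intro c hc hAc
  obtain ⟨b, hb⟩ := hX (fun s => e.symm (c s)) (fun s hs => by simp [hc s hs]) (by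
    have := mact_comp A e.symm.toLinearMap c
    simp only [LinearEquiv.coe_coe] at this
    rw [this, hAc]; ext; simp)
  refine ⟨fun s => e (b s), ?_⟩
  have := mact_comp A e.toLinearMap b
  simp only [LinearEquiv.coe_coe] at this
  rw [this, hb]; ext; simp

lemma van_zero_surj (hw : ∀ s, 0 ≤ w s) (h : Homog A w) (g : X →ₗ[R] Y)
    (hg : Function.Surjective g) (hX : Van A w 0 X) : Van A w 0 Y := by
  intro c hc _
  choose c'' hc'' using fun s => hg (c s)
  obtain ⟨b, hb⟩ := hX (comp w 0 c'') (comp_deg _ _ _) (by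
    have := mact_comp_deg h (-1) c''
    rw [neg_add_cancel] at this
    rw [this]
    ext s
    apply comp_deg
    have := hw s
    omega)
  refine ⟨fun s => g (b s), ?_⟩
  rw [mact_comp, hb]
  ext s
  simp only [comp]
  split_ifs with hs
  · exact hc'' s
  · simp [hc s hs]

end Mat

/-- existence of Koszul matrices -/
def HasK {R : Type} [CommRing R] (I : Ideal R) : Prop :=
  ∃ (S : Type) (_ : Fintype S) (_ : DecidableEq S) (w : S → ℤ) (A : Matrix S S R),
    A * A = 0 ∧ Homog A w ∧ (∀ s, 0 ≤ w s) ∧ (∃ s, w s = 0) ∧ (∀ s t, A s t ∈ I) ∧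
    ∀ x ∈ I, ∃ h : Matrix S S R, A * h + h * A = x • (1 : Matrix S S R)

lemma hasK_bot {R : Type} [CommRing R] : HasK (⊥ : Ideal R) := by
  refine ⟨Unit, inferInstance, inferInstance, fun _ => 0, 0, by simp, ?_, by simp, by simp, by simp, ?_⟩
  · intro s t h; simp at h
  · intro x hx
    exact ⟨0, by simp [(Submodule.mem_bot R).1 hx]⟩

lemma hasK_sup {R : Type} [CommRing R] (x : R) (I : Ideal R) (hI : HasK I) :
    HasK (Ideal.span {x} ⊔ I) := by
  obtain ⟨S, _, _, w, A, hAA, hH, hw, ⟨s0, hs0⟩, hAI, hh⟩ := hI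
  refine ⟨S ⊕ S, inferInstance, inferInstance, Sum.elim w (fun s => w s + 1),
    Matrix.fromBlocks A (x • 1) 0 (-A), ?_, ?_, ?_, ⟨Sum.inl s0, hs0⟩, ?_, ?_⟩
  · simp [Matrix.fromBlocks_multiply, hAA]
  · rintro (s | s) (t | t) hst
    · exact hH s t hst
    · simp only [Matrix.fromBlocks_apply₁₂, Matrix.smul_apply, Matrix.one_apply] at hst
      split_ifs at hst with h
      · subst h; simp
      · simp at hst
    · simp at hst
    · simp only [Matrix.fromBlocks_apply₂₂, Matrix.neg_apply, ne_eq, neg_eq_zero] at hst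
      have := hH s t hst
      simp [this]
  · rintro (s | s)
    · exact hw s
    · have := hw s
      simp; omega
  · have hx : x ∈ Ideal.span {x} ⊔ I :=
      Ideal.mem_sup_left (Ideal.mem_span_singleton_self x)
    rintro (s | s) (t | t)
    · exact Ideal.mem_sup_right (hAI s t)
    · simp only [Matrix.fromBlocks_apply₁₂, Matrix.smul_apply, smul_eq_mul]
      exact Ideal.mul_mem_right _ _ hx
    · simp
    · simp only [Matrix.fromBlocks_apply₂₂, Matrix.neg_apply]
      exact neg_mem (Ideal.mem_sup_right (hAI s t))
  · intro y hy
    obtain ⟨a, ha, b, hb, rfl⟩ := Submodule.mem_sup.1 hy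
    obtain ⟨r, rfl⟩ := Ideal.mem_span_singleton'.1 ha
    obtain ⟨h, hh⟩ := hh b hb
    refine ⟨Matrix.fromBlocks h 0 (r • 1) (-h), ?_⟩
    have h1 : h * A = b • 1 - A * h := by rw [← hh]; abel
    rw [Matrix.fromBlocks_multiply, Matrix.fromBlocks_multiply, Matrix.fromBlocks_add,
      ← Matrix.fromBlocks_one, Matrix.fromBlocks_smul]
    congr 1
    · simp [h1, add_smul, smul_smul]
      abel
    · simp
    · simp
    · simp [h1, add_smul, smul_smul, mul_comm x r]
      abel

lemma hasK {R : Type} [CommRing R] [IsNoetherianRing R] (I : Ideal R) : HasK I := by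
  classical
  obtain ⟨s, rfl⟩ := (IsNoetherian.noetherian I : I.FG)
  induction s using Finset.induction_on with
  | empty => simpa using hasK_bot
  | insert x s _ ih =>
    rw [Finset.coe_insert]
    have := hasK_sup x _ ih
    rwa [← Submodule.span_insert] at this

section Inj
variable {R : Type} [CommRing R]

lemma inj_ext {Q : Type} [AddCommGroup Q] [Module R Q] (hQ : Module.Injective R Q)
    {X Y : Type} [AddCommGroup X] [Module R X] [AddCommGroup Y] [Module R Y]
    (φ : X →ₗ[R] Y) (c : X →ₗ[R] Q) (h : LinearMap.ker φ ≤ LinearMap.ker c) :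
    ∃ b : Y →ₗ[R] Q, b ∘ₗ φ = c := by
  obtain ⟨b, hb⟩ := hQ.out (Submodule.liftQ (LinearMap.ker φ) φ le_rfl)
    (by rw [← LinearMap.ker_eq_bot]; exact Submodule.ker_liftQ_eq_bot _ _ _ le_rfl)
    (Submodule.liftQ (LinearMap.ker φ) c h)
  refine ⟨b, ?_⟩
  ext x
  have := hb (Submodule.Quotient.mk x)
  simpa using this

lemma van_inj {S : Type} [Fintype S] [DecidableEq S] (I : Ideal R) (A : Matrix S S R) (w : S → ℤ)
    (hh : ∀ x ∈ I, ∃ h : Matrix S S R, A * h + h * A = x • (1 : Matrix S S R))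
    {Q : Type} [AddCommGroup Q] [Module R Q] (hQ : Module.Injective R Q)
    (hI : ∀ q : Q, (∀ x ∈ I, x • q = 0) → q = 0) (j : ℤ) : Van A w j Q := by
  intro c _ hAc
  let L : (S → Q) → ((S → R) →ₗ[R] Q) := fun c => Fintype.linearCombination R c
  have hL : ∀ c v, L c v = ∑ s, v s • c s := fun c v => Fintype.linearCombination_apply R c v
  have hLA : ∀ c v, L (mact A c) v = L c (Matrix.vecMul v A) := by
    intro c v
    simp only [hL, mact_apply, Matrix.vecMul, dotProduct, Finset.smul_sum, Finset.sum_smul, smul_smul]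
    exact Finset.sum_comm
  obtain ⟨b, hb⟩ := inj_ext hQ (Matrix.vecMulLinear A) (L c) (by
    intro v hv
    have hv' : Matrix.vecMul v A = 0 := hv
    rw [LinearMap.mem_ker]
    apply hI
    intro x hx
    obtain ⟨h, hh⟩ := hh x hx
    have h1 : x • v = Matrix.vecMul (Matrix.vecMul v h) A := by
      have := congrArg (Matrix.vecMul v) hh
      rw [Matrix.vecMul_add, ← Matrix.vecMul_vecMul, ← Matrix.vecMul_vecMul, hv',
        Matrix.zero_vecMul, zero_add] at this
      rw [this]
      simp [Matrix.vecMul_smul]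
    rw [← map_smul, h1, ← hLA, hAc]
    simp [hL])
  refine ⟨fun s => b (Pi.single s 1), ?_⟩
  have hb' : L (fun s => b (Pi.single s 1)) = b := by
    ext s
    simp [hL]
  have : ∀ c d, L c = L d → c = d := by
    intro c d h
    ext s
    have := congrArg (fun f => f (Pi.single s 1)) h
    simpa [hL, Pi.single_apply] using this
  apply this
  ext s : 2
  rw [LinearMap.comp_apply, LinearMap.comp_apply, hLA, hb', ← hb]
  rfl

/-- cogenerator property -/
def Cogen (R : Type) [CommRing R] (E : Type) [AddCommGroup E] [Module R E] : Prop :=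
  ∀ (Y : Type) [AddCommGroup Y] [Module R Y] (N : Submodule R Y) (y : Y), y ∉ N →
    ∃ φ : Y →ₗ[R] E, (∀ n ∈ N, φ n = 0) ∧ φ y ≠ 0

open DirectSum in
lemma cogen {E : Type} [AddCommGroup E] [Module R E] (hE : Module.Injective R E)
    (f : (⨁ m : MaximalSpectrum R, R ⧸ m.asIdeal) →ₗ[R] E) (hf : Function.Injective f) :
    Cogen R E := by
  classical
  intro Y _ _ N y hy
  let z : Y ⧸ N := N.mkQ y
  have hz : z ≠ 0 := by
    intro h; exact hy ((Submodule.Quotient.mk_eq_zero N).1 h)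
  let J : Ideal R := LinearMap.ker (LinearMap.toSpanSingleton R (Y ⧸ N) z)
  have hJ : J ≠ ⊤ := by
    intro h
    have : (1 : R) ∈ J := by rw [h]; trivial
    apply hz
    simpa [J] using this
  obtain ⟨m, hm, hJm⟩ := Ideal.exists_le_maximal J hJ
  let i : R →ₗ[R] E := f ∘ₗ (DirectSum.lof R (MaximalSpectrum R) (fun m => R ⧸ m.asIdeal) ⟨m, hm⟩) ∘ₗ
    (Submodule.mkQ m)
  have hi : ∀ r, i r = 0 → r ∈ m := by
    intro r hr
    have h1 := hf (hr.trans (map_zero f).symm)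
    have h2 : Submodule.mkQ m r = 0 := by
      have := DirectSum.of_injective (β := fun m : MaximalSpectrum R => R ⧸ m.asIdeal) ⟨m, hm⟩
      exact this (h1.trans (map_zero _).symm)
    exact (Submodule.Quotient.mk_eq_zero m).1 h2
  obtain ⟨b, hb⟩ := inj_ext hE (LinearMap.toSpanSingleton R (Y ⧸ N) z) i (by
    intro r hr
    have : r ∈ m := hJm hr
    have h0 : Submodule.mkQ m r = 0 := (Submodule.Quotient.mk_eq_zero m).2 this
    simp only [LinearMap.mem_ker, i, LinearMap.comp_apply]
    rw [h0, map_zero, map_zero])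
  refine ⟨b ∘ₗ N.mkQ, ?_, ?_⟩
  · intro n hn
    have : N.mkQ n = 0 := (Submodule.Quotient.mk_eq_zero N).2 hn
    rw [LinearMap.comp_apply, this, map_zero]
  · intro h0
    have h1 : i 1 = 0 := by
      rw [← hb]; simpa [z] using h0
    exact hm.ne_top ((Ideal.eq_top_iff_one m).2 (hi 1 h1))

lemma van_dual {S : Type} [Fintype S] (A : Matrix S S R) (w : S → ℤ) (hH : Homog A w)
    {E : Type} [AddCommGroup E] [Module R E] (hE : Cogen R E)
    {X : Type} [AddCommGroup X] [Module R X]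
    (hD : ∀ j, Van A.transpose (fun s => - w s) j (X →ₗ[R] E)) (j : ℤ) : Van A w j X := by
  classical
  intro c hc hAc
  by_contra hcon
  have hcr : c ∉ LinearMap.range (mact A (X := X)) := by
    rintro ⟨b, hb⟩; exact hcon ⟨b, hb⟩
  obtain ⟨φ, hφ, hφc⟩ := hE _ _ c hcr
  let p : S → (X →ₗ[R] E) := fun s => if w s = j then φ ∘ₗ LinearMap.single R (fun _ => X) s else 0
  have hsum : ∀ y : S → X, φ y = ∑ s, φ (Pi.single s (y s)) := by
    intro y
    rw [← map_sum]
    congr 1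
    exact (LinearMap.sum_single_apply (fun _ => X) y).symm
  obtain ⟨ψ, hψ⟩ := hD (-j) p (by
    intro s hs
    simp only [p]
    rw [if_neg]
    intro h; exact hs (by simp [h])) (by
    ext t x
    rw [mact_apply]
    simp only [Matrix.transpose_apply, LinearMap.sum_apply, LinearMap.smul_apply, Pi.zero_apply,
      LinearMap.zero_apply]
    by_cases ht : w t = j + 1
    · have h1 := hφ (mact A (Pi.single t x)) ⟨_, rfl⟩
      rw [hsum] at h1
      rw [← h1]
      apply Finset.sum_congr rfl
      intro s _
      have h2 : mact A (Pi.single t x) s = A s t • x := by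
        rw [mact_apply, Finset.sum_eq_single t] <;> simp +contextual
      rw [h2]
      by_cases hA : A s t = 0
      · simp [hA]
      · have := hH s t hA
        have hs : w s = j := by omega
        simp only [p, hs, if_true, LinearMap.comp_apply, LinearMap.single_apply]
        rw [← map_smul, ← Pi.single_smul]
    · apply Finset.sum_eq_zero
      intro s _
      by_cases hA : A s t = 0
      · simp [hA]
      · have := hH s t hA
        have hs : w s ≠ j := by omega
        simp [p, hs])
  apply hφc
  have h3 : φ c = ∑ s, p s (c s) := by
    rw [hsum]
    apply Finset.sum_congr rfl
    intro s _
    by_cases hs : w s = j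
    · simp [p, hs]
    · simp [hc s hs]
  rw [h3, ← hψ]
  simp only [mact_apply, Matrix.transpose_apply, LinearMap.sum_apply, LinearMap.smul_apply]
  rw [Finset.sum_comm]
  apply Finset.sum_eq_zero
  intro t _
  have := congrFun hAc t
  rw [mact_apply] at this
  simp only [← map_smul, ← map_sum, this]
  simp

end Inj
end Kz

open CategoryTheory

namespace Kz
section Gam
variable {R : Type} [CommRing R] (I : Ideal R)

/-- torsion submodule -/
def Gam (X : Type) [AddCommGroup X] [Module R X] : Submodule R X where
  carrier := {x | ∃ k : ℕ, ∀ r ∈ I ^ k, r • x = 0}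
  zero_mem' := ⟨0, by simp⟩
  add_mem' := by
    rintro a b ⟨k, hk⟩ ⟨l, hl⟩
    refine ⟨max k l, fun r hr => ?_⟩
    rw [smul_add, hk r (Ideal.pow_le_pow_right (le_max_left _ _) hr),
      hl r (Ideal.pow_le_pow_right (le_max_right _ _) hr), add_zero]
  smul_mem' := by
    rintro c x ⟨k, hk⟩
    exact ⟨k, fun r hr => by rw [smul_comm, hk r hr, smul_zero]⟩

variable {I}
variable {X : Type} [AddCommGroup X] [Module R X]
lemma mem_Gam {x : X} : x ∈ Gam I X ↔ ∃ k : ℕ, ∀ r ∈ I ^ k, r • x = 0 := Iff.rfl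

lemma Gam_map {Y : Type} [AddCommGroup Y] [Module R Y] (f : X →ₗ[R] Y) {x : X} (hx : x ∈ Gam I X) :
    f x ∈ Gam I Y := by
  obtain ⟨k, hk⟩ := hx
  exact ⟨k, fun r hr => by rw [← map_smul, hk r hr, map_zero]⟩

/-- finitely generated submodules of the torsion are killed uniformly -/
lemma unif (N : Submodule R X) (hN : N.FG) (h : N ≤ Gam I X) :
    ∃ k : ℕ, ∀ r ∈ I ^ k, ∀ x ∈ N, r • x = 0 := by
  obtain ⟨s, rfl⟩ := hN
  choose! k hk using fun x (hx : x ∈ (s : Set X)) => mem_Gam.1 (h (Submodule.subset_span hx))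
  refine ⟨s.sup k, fun r hr x hx => ?_⟩
  induction hx using Submodule.span_induction with
  | mem x hx => exact hk x hx r (Ideal.pow_le_pow_right (Finset.le_sup hx) hr)
  | zero => simp
  | add a b _ _ ha hb => rw [smul_add, ha, hb, add_zero]
  | smul c a _ ha => rw [smul_comm, ha, smul_zero]

variable [IsNoetherianRing R]

lemma Gam_inj (hJ : Module.Injective R X) : Module.Injective R (Gam I X) := by
  apply Module.Baer.injective
  intro b g
  let g' : b →ₗ[R] X := (Gam I X).subtype ∘ₗ g
  obtain ⟨k, hk⟩ := unif (I := I) (LinearMap.range g')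
    ((IsNoetherian.noetherian (⊤ : Submodule R b)).map g' |> fun h => by
      rwa [Submodule.map_top] at h) (by
      rintro _ ⟨x, rfl⟩
      exact (g x).2)
  obtain ⟨m, hm⟩ := Ideal.exists_pow_inf_eq_pow_smul I (N := (b : Submodule R R))
  have hm' := hm (m + k) (by omega)
  rw [Nat.add_sub_cancel_left] at hm'
  obtain ⟨c, hc⟩ := inj_ext hJ ((Submodule.mkQ (I ^ (m + k))) ∘ₗ (b.subtype : b →ₗ[R] R)) g' (by
    intro x hx
    have hx1 : (x : R) ∈ I ^ (m + k) := by
      have : Submodule.mkQ (I ^ (m + k)) (x : R) = 0 := hx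
      exact (Submodule.Quotient.mk_eq_zero _).1 this
    have hx2 : (x : R) ∈ I ^ (m+k) • (⊤ : Submodule R R) ⊓ b := ⟨by simpa using hx1, x.2⟩
    rw [hm'] at hx2
    have key : ∀ y ∈ I ^ k • (I ^ m • (⊤ : Submodule R R) ⊓ b), ∃ h : y ∈ b, g' ⟨y, h⟩ = 0 := by
      intro y hy
      refine Submodule.smul_induction_on hy ?_ ?_
      · rintro r hr z ⟨_, hz⟩
        refine ⟨b.smul_mem r hz, ?_⟩
        have : (⟨r • z, b.smul_mem r hz⟩ : b) = r • ⟨z, hz⟩ := rfl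
        rw [this, map_smul]
        exact hk r hr _ ⟨_, rfl⟩
      · rintro x y ⟨hx, hx'⟩ ⟨hy, hy'⟩
        refine ⟨b.add_mem hx hy, ?_⟩
        have : (⟨x + y, b.add_mem hx hy⟩ : b) = ⟨x, hx⟩ + ⟨y, hy⟩ := rfl
        rw [this, map_add, hx', hy', add_zero]
    obtain ⟨_, h⟩ := key _ hx2
    exact h)
  let c' : R →ₗ[R] X := c ∘ₗ Submodule.mkQ (I ^ (m + k))
  have hc' : ∀ r, c' r ∈ Gam I X := by
    intro r
    refine ⟨m + k, fun s hs => ?_⟩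
    rw [← map_smul]
    have : Submodule.mkQ (I ^ (m + k)) (s • r) = 0 :=
      (Submodule.Quotient.mk_eq_zero _).2 (Ideal.mul_mem_right _ _ hs)
    simp only [c', LinearMap.comp_apply]
    rw [this, map_zero]
  refine ⟨c'.codRestrict _ hc', fun x hx => ?_⟩
  apply Subtype.ext
  have := congrArg (fun f => f ⟨x, hx⟩) hc
  exact this

lemma Q_inj (hJ : Module.Injective R X) : Module.Injective R (X ⧸ Gam I X) := by
  have hG := Gam_inj (I := I) hJ
  obtain ⟨p, hp⟩ := inj_ext hG (Gam I X).subtype LinearMap.id (by simp)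
  have hp' : ∀ x : Gam I X, p x = x := fun x => congrArg (fun f => f x) hp
  let s : (X ⧸ Gam I X) →ₗ[R] X := Submodule.liftQ _ (LinearMap.id - (Gam I X).subtype ∘ₗ p) (by
    intro x hx
    have := hp' ⟨x, hx⟩
    simp only at this
    simp [this])
  have hs : ∀ q, (Gam I X).mkQ (s q) = q := by
    intro q
    obtain ⟨x, rfl⟩ := Submodule.mkQ_surjective _ q
    simp [s]
  constructor
  intro A B _ _ _ _ f hf g
  obtain ⟨h, hh⟩ := hJ.out f hf (s ∘ₗ g)
  refine ⟨(Gam I X).mkQ ∘ₗ h, fun x => ?_⟩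
  rw [LinearMap.comp_apply, hh, LinearMap.comp_apply, hs]

lemma Q_free (q : X ⧸ Gam I X) (hq : ∀ r ∈ I, r • q = 0) : q = 0 := by
  obtain ⟨x, rfl⟩ := Submodule.mkQ_surjective _ q
  have h1 : ∀ r ∈ I, r • x ∈ Gam I X := by
    intro r hr
    have := hq r hr
    rw [← map_smul] at this
    exact (Submodule.Quotient.mk_eq_zero _).1 this
  let φ := LinearMap.toSpanSingleton R X x
  obtain ⟨k, hk⟩ := unif (I := I) (Submodule.map φ I) ((IsNoetherian.noetherian I).map _) (by
    rintro _ ⟨r, hr, rfl⟩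
    exact h1 r hr)
  apply (Submodule.Quotient.mk_eq_zero _).2
  refine ⟨k + 1, ?_⟩
  intro r hr
  rw [pow_succ] at hr
  refine Submodule.mul_induction_on hr ?_ ?_
  · intro a ha b hb
    rw [mul_smul]
    exact hk a ha _ ⟨b, hb, rfl⟩
  · intro a b ha hb
    rw [add_smul, ha, hb, add_zero]

end Gam

lemma enough {R : Type} [CommRing R] (X : Type) [AddCommGroup X] [Module R X] :
    ∃ (J : Type) (_ : AddCommGroup J) (_ : Module R J) (f : X →ₗ[R] J),
      Module.Injective R J ∧ Function.Injective f := by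
  let U := Injective.under (ModuleCat.of R X)
  refine ⟨U, inferInstance, inferInstance, (Injective.ι (ModuleCat.of R X)).hom, ?_, ?_⟩
  · have : Injective (ModuleCat.of R U) := inferInstanceAs (Injective (Injective.under (ModuleCat.of R X)))
    exact Module.injective_module_of_injective_object R U
  · exact (ModuleCat.mono_iff_injective _).1 inferInstance

end Kz

open CategoryTheory

namespace Kz

section ExtI
open Opposite
variable {R : Type} [CommRing R] {X : ModuleCat.{0} R} (P : ProjectiveResolution X)

/-- cocycles -/
def Zc (n : ℕ) (Y : ModuleCat.{0} R) : Submodule R (P.complex.X n →ₗ[R] Y) where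
  carrier := {φ | φ ∘ₗ (P.complex.d (n+1) n).hom = 0}
  add_mem' {a b} ha hb := by
    simp only [Set.mem_ofPred_eq] at *
    rw [LinearMap.add_comp, ha, hb, add_zero]
  zero_mem' := by simp
  smul_mem' r a ha := by
    simp only [Set.mem_ofPred_eq] at *
    rw [LinearMap.smul_comp, ha, smul_zero]

/-- op complex -/
noncomputable abbrev Kc (Y : ModuleCat.{0} R) : ChainComplex (ModuleCat.{0} R)ᵒᵖ ℕ :=
  (((linearYoneda R (ModuleCat.{0} R)).obj Y).rightOp.mapHomologicalComplex _).obj P.complex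

/-- inclusion of cocycles -/
def zi (n : ℕ) (Y : ModuleCat.{0} R) : ModuleCat.of R (Zc P n Y) ⟶ ((Kc P Y).X n).unop :=
  ModuleCat.ofHom
    { toFun := fun φ => (ModuleCat.ofHom φ.1 : P.complex.X n ⟶ Y)
      map_add' := fun _ _ => rfl
      map_smul' := fun _ _ => rfl }

lemma d_zi (n : ℕ) (Y : ModuleCat.{0} R) : (Kc P Y).d (n+1) n ≫ (zi P n Y).op = 0 := by
  apply Quiver.Hom.unop_inj
  ext φ
  have := φ.2
  change (P.complex.d (n+1) n) ≫ (ModuleCat.ofHom φ.1) = 0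
  ext x
  exact congrArg (fun f => f x) this

noncomputable def zo (n : ℕ) (Y : ModuleCat.{0} R) : ModuleCat.of R (Zc P n Y) ⟶ ((Kc P Y).opcycles n).unop :=
  ((Kc P Y).descOpcycles (zi P n Y).op (n+1) (by simp) (d_zi P n Y)).unop

lemma zo_p (n : ℕ) (Y : ModuleCat.{0} R) : zo P n Y ≫ ((Kc P Y).pOpcycles n).unop = zi P n Y := by
  apply Quiver.Hom.op_inj
  exact (Kc P Y).p_descOpcycles (zi P n Y).op (n+1) (by simp) (d_zi P n Y)

/-- class map -/
noncomputable def clsM (n : ℕ) (Y : ModuleCat.{0} R) :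
    ModuleCat.of R (Zc P n Y) ⟶ ((Ext R (ModuleCat.{0} R) n).obj (op X)).obj Y :=
  zo P n Y ≫ ((Kc P Y).homologyι n).unop ≫
    (P.isoLeftDerivedObj ((linearYoneda R (ModuleCat.{0} R)).obj Y).rightOp n).hom.unop

lemma zo_surj (n : ℕ) (Y : ModuleCat.{0} R) : Function.Surjective (zo P n Y).hom := by
  intro y
  have hm : Function.Injective ((Kc P Y).pOpcycles n).unop.hom := by
    exact (ModuleCat.mono_iff_injective ((Kc P Y).pOpcycles n).unop).1 inferInstance
  let φ : P.complex.X n ⟶ Y := ((Kc P Y).pOpcycles n).unop.hom y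
  have h0 : ((Kc P Y).pOpcycles n).unop ≫ ((Kc P Y).d (n+1) n).unop = 0 := by
    rw [← unop_comp, HomologicalComplex.d_pOpcycles]; rfl
  have hφ : P.complex.d (n+1) n ≫ φ = 0 := by
    have := congrArg (fun f => f.hom y) h0
    exact this
  refine ⟨⟨φ.hom, ?_⟩, ?_⟩
  · have := congrArg ModuleCat.Hom.hom hφ
    exact this
  · apply hm
    have := congrArg (fun f => f.hom ⟨φ.hom, congrArg ModuleCat.Hom.hom hφ⟩) (zo_p P n Y)
    exact this

lemma clsM_surj (n : ℕ) (Y : ModuleCat.{0} R) : Function.Surjective (clsM P n Y).hom := by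
  have h1 := (ModuleCat.epi_iff_surjective ((Kc P Y).homologyι n).unop).1 inferInstance
  have h2 := (ModuleCat.epi_iff_surjective (P.isoLeftDerivedObj
    ((linearYoneda R (ModuleCat.{0} R)).obj Y).rightOp n).hom.unop).1 inferInstance
  exact h2.comp (h1.comp (zo_surj P n Y))

lemma clsM_zero (n : ℕ) (Y : ModuleCat.{0} R) (φ : Zc P n Y) (h : (clsM P n Y).hom φ = 0)
   (m : ℕ) (hm : (ComplexShape.down ℕ).next n = m) :
    ∃ ψ : P.complex.X m →ₗ[R] Y, φ.1 = ψ ∘ₗ (P.complex.d n m).hom := by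
  have h1 : ((Kc P Y).homologyι n).unop.hom ((zo P n Y).hom φ) = 0 := by
    have hi : Function.Injective (P.isoLeftDerivedObj ((linearYoneda R (ModuleCat.{0} R)).obj Y).rightOp n).hom.unop.hom :=
      (ModuleCat.mono_iff_injective _).1 inferInstance
    exact hi (h.trans (map_zero _).symm)
  let T : ShortComplex (ModuleCat.{0} R)ᵒᵖ := ShortComplex.mk ((Kc P Y).homologyι n) ((Kc P Y).fromOpcycles n m) (by simp)
  have hT : T.Exact := ShortComplex.exact_of_f_is_kernel _ ((Kc P Y).homologyIsKernel n m hm)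
  have hT' := hT.unop
  rw [ShortComplex.moduleCat_exact_iff] at hT'
  obtain ⟨ψ, hψ⟩ := hT' _ h1
  have hψ' : ((Kc P Y).fromOpcycles n m).unop.hom ψ = (zo P n Y).hom φ := hψ
  have h2 : ((Kc P Y).fromOpcycles n m).unop ≫ ((Kc P Y).pOpcycles n).unop = ((Kc P Y).d n m).unop := by
    rw [← unop_comp, HomologicalComplex.p_fromOpcycles]
  let ψ' : P.complex.X m ⟶ Y := ψ
  have h3 : (ModuleCat.ofHom φ.1 : P.complex.X n ⟶ Y) = P.complex.d n m ≫ ψ' := by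
    have e1 := congrArg (fun f => f.hom φ) (zo_p P n Y)
    have e2 := congrArg (fun f => f.hom ψ) h2
    have e3 := congrArg (((Kc P Y).pOpcycles n).unop.hom) hψ'
    exact (e1.symm.trans e3.symm).trans e2
  exact ⟨ψ'.hom, congrArg ModuleCat.Hom.hom h3⟩

lemma clsM_bdry (n : ℕ) (Y : ModuleCat.{0} R) (φ : Zc P n Y)
   (m : ℕ) (ψ : P.complex.X m →ₗ[R] Y) (h : φ.1 = ψ ∘ₗ (P.complex.d n m).hom) :
    (clsM P n Y).hom φ = 0 := by
  have h1 : ((Kc P Y).homologyι n).unop.hom ((zo P n Y).hom φ) = 0 := by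
    have hz : (zo P n Y).hom φ = ((Kc P Y).fromOpcycles n m).unop.hom (ModuleCat.ofHom ψ) := by
      have hm : Function.Injective ((Kc P Y).pOpcycles n).unop.hom := by
        exact (ModuleCat.mono_iff_injective ((Kc P Y).pOpcycles n).unop).1 inferInstance
      apply hm
      have e1 := congrArg (fun f => f.hom φ) (zo_p P n Y)
      have h2 : ((Kc P Y).fromOpcycles n m).unop ≫ ((Kc P Y).pOpcycles n).unop = ((Kc P Y).d n m).unop := by
        rw [← unop_comp, HomologicalComplex.p_fromOpcycles]
      have e2 := congrArg (fun f => f.hom (ModuleCat.ofHom ψ)) h2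
      have h3 : (ModuleCat.ofHom φ.1 : P.complex.X n ⟶ Y) = P.complex.d n m ≫ ModuleCat.ofHom ψ := by
        ext x; rw [ModuleCat.hom_ofHom, h]; rfl
      exact (e1.trans h3).trans e2.symm
    rw [hz]
    have h4 : ((Kc P Y).fromOpcycles n m).unop ≫ ((Kc P Y).homologyι n).unop = 0 := by
      rw [← unop_comp, HomologicalComplex.homologyι_comp_fromOpcycles]; rfl
    exact congrArg (fun f => f.hom (ModuleCat.ofHom ψ)) h4
  have : (clsM P n Y).hom φ = (P.isoLeftDerivedObj ((linearYoneda R (ModuleCat.{0} R)).obj Y).rightOp n).hom.unop.hom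
      (((Kc P Y).homologyι n).unop.hom ((zo P n Y).hom φ)) := rfl
  rw [this, h1]
  exact map_zero _

variable {P}
lemma clsM_nat {X' : ModuleCat.{0} R} {P' : ProjectiveResolution X'} (f : X ⟶ X')
    (τ : P.complex ⟶ P'.complex) (comm : τ.f 0 ≫ P'.π.f 0 = P.π.f 0 ≫ f)
    (n : ℕ) (Y : ModuleCat.{0} R) (φ : Zc P' n Y) (φ' : Zc P n Y) (h : φ'.1 = φ.1 ∘ₗ (τ.f n).hom) :
    (clsM P n Y).hom φ' = (((Ext R (ModuleCat.{0} R) n).map f.op).app Y).hom ((clsM P' n Y).hom φ) := by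
  let F := ((linearYoneda R (ModuleCat.{0} R)).obj Y).rightOp
  let T : Kc P Y ⟶ Kc P' Y := (F.mapHomologicalComplex _).map τ
  have h1 : (zo P n Y).hom φ' = (HomologicalComplex.opcyclesMap T n).unop.hom ((zo P' n Y).hom φ) := by
    have hm : Function.Injective ((Kc P Y).pOpcycles n).unop.hom := by
        exact (ModuleCat.mono_iff_injective ((Kc P Y).pOpcycles n).unop).1 inferInstance
    apply hm
    have e1 := congrArg (fun f => f.hom φ') (zo_p P n Y)
    have h2 := congrArg Quiver.Hom.unop (HomologicalComplex.p_opcyclesMap T n)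
    have e2 := congrArg (fun f => f.hom ((zo P' n Y).hom φ)) h2
    have e3 := congrArg (fun f => (T.f n).unop.hom (f.hom φ)) (zo_p P' n Y)
    have h3 : (ModuleCat.ofHom φ'.1 : P.complex.X n ⟶ Y) = τ.f n ≫ ModuleCat.ofHom φ.1 := by
        ext x; rw [ModuleCat.hom_ofHom, h]; rfl
    exact (e1.trans h3).trans (e3.symm.trans e2.symm)
  have h4 := congrArg Quiver.Hom.unop (HomologicalComplex.homologyι_naturality T n)
  have h5 := congrArg Quiver.Hom.unop (ProjectiveResolution.isoLeftDerivedObj_hom_naturality f P P' τ comm F n)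
  have e4 := congrArg (fun f => f.hom ((zo P' n Y).hom φ)) h4
  have e5 := congrArg (fun f => f.hom (((Kc P' Y).homologyι n).unop.hom ((zo P' n Y).hom φ))) h5
  have e6 : (((Kc P Y).homologyι n).unop.hom ((zo P n Y).hom φ')) = (HomologicalComplex.homologyMap T n).unop.hom
     (((Kc P' Y).homologyι n).unop.hom ((zo P' n Y).hom φ)) := by
    rw [h1]; exact e4.symm
  have : (clsM P n Y).hom φ' = (P.isoLeftDerivedObj F n).hom.unop.hom
      (((Kc P Y).homologyι n).unop.hom ((zo P n Y).hom φ')) := rfl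
  rw [this, e6]
  exact e5.symm

end ExtI
end Kz

open CategoryTheory

namespace Kz
section Ch
variable {R : Type} [CommRing R]
variable {A J C : Type} [AddCommGroup A] [Module R A] [AddCommGroup J] [Module R J]
  [AddCommGroup C] [Module R C]

lemma ker_factor {f : A →ₗ[R] J} {g : J →ₗ[R] C} (hf : Function.Injective f)
    (hfg : Function.Exact f g) {T : Type} [AddCommGroup T] [Module R T] (θ : T →ₗ[R] J)
    (h : g ∘ₗ θ = 0) : ∃ χ : T →ₗ[R] A, f ∘ₗ χ = θ := by
  have h' : ∀ t, θ t ∈ LinearMap.range f := by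
    intro t
    have := congrArg (fun f => f t) h
    exact (hfg _).1 this
  refine ⟨(LinearEquiv.ofInjective f hf).symm.toLinearMap ∘ₗ θ.codRestrict _ h', ?_⟩
  ext t
  have := LinearEquiv.apply_symm_apply (LinearEquiv.ofInjective f hf) (θ.codRestrict _ h' t)
  exact congrArg Subtype.val this

variable (I : Ideal R) {f : A →ₗ[R] J} {g : J →ₗ[R] C}

/-- quotient maps -/
def qmap (f : A →ₗ[R] J) : (A ⧸ Gam I A) →ₗ[R] (J ⧸ Gam I J) :=
  Submodule.mapQ _ _ f (fun _ hx => Gam_map f hx)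

def lmap (g : J →ₗ[R] C) : (J ⧸ Gam I J) →ₗ[R] (C ⧸ (Gam I J).map g) :=
  Submodule.mapQ _ _ g (Submodule.le_comap_map _ _)

def dmap (g : J →ₗ[R] C) : (C ⧸ (Gam I J).map g) →ₗ[R] (C ⧸ Gam I C) :=
  Submodule.mapQ _ _ LinearMap.id (by
    rintro _ ⟨x, hx, rfl⟩
    exact Gam_map g hx)

lemma mk0 {X : Type} [AddCommGroup X] [Module R X] (N : Submodule R X) (x : X) : N.mkQ x = 0 ↔ x ∈ N :=
  Submodule.Quotient.mk_eq_zero N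

lemma qmap_inj (hf : Function.Injective f) : Function.Injective (qmap I f) := by
  rw [injective_iff_map_eq_zero]
  intro q hq
  obtain ⟨x, rfl⟩ := Submodule.mkQ_surjective _ q
  have h1 : f x ∈ Gam I J := (mk0 _ _).1 hq
  obtain ⟨k, hk⟩ := h1
  apply (mk0 _ _).2
  refine ⟨k, fun r hr => ?_⟩
  apply hf
  rw [map_smul, hk r hr, map_zero]

lemma lmap_surj (hg : Function.Surjective g) : Function.Surjective (lmap I g) := by
  intro q
  obtain ⟨x, rfl⟩ := Submodule.mkQ_surjective _ q
  obtain ⟨y, rfl⟩ := hg x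
  exact ⟨(Gam I J).mkQ y, rfl⟩

lemma dmap_surj : Function.Surjective (dmap I g) := by
  intro q
  obtain ⟨x, rfl⟩ := Submodule.mkQ_surjective _ q
  exact ⟨Submodule.mkQ _ x, rfl⟩

lemma ql_exact (hfg : Function.Exact f g) : Function.Exact (qmap I f) (lmap I g) := by
  intro q
  constructor
  · intro hq
    obtain ⟨x, rfl⟩ := Submodule.mkQ_surjective _ q
    obtain ⟨y, hy, hyx⟩ : g x ∈ (Gam I J).map g := (mk0 _ _).1 hq
    obtain ⟨a, ha⟩ := (hfg (x - y)).1 (by rw [map_sub, hyx, sub_self])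
    refine ⟨(Gam I A).mkQ a, ?_⟩
    have : qmap I f ((Gam I A).mkQ a) = (Gam I J).mkQ (f a) := rfl
    rw [this, ha, map_sub, (mk0 _ y).2 hy, sub_zero]
  · rintro ⟨a, rfl⟩
    obtain ⟨a, rfl⟩ := Submodule.mkQ_surjective _ a
    have : lmap I g (qmap I f ((Gam I A).mkQ a)) = Submodule.mkQ _ (g (f a)) := rfl
    rw [this, hfg.apply_apply_eq_zero, map_zero]

lemma d_exact {H : Type} [AddCommGroup H] [Module R H] (Θ : H →ₗ[R] (C ⧸ (Gam I J).map g))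
    (hΘ : LinearMap.range Θ = (Gam I C).map (Submodule.mkQ _)) : Function.Exact Θ (dmap I g) := by
  intro q
  obtain ⟨x, rfl⟩ := Submodule.mkQ_surjective _ q
  change _ ↔ _ ∈ LinearMap.range Θ
  rw [hΘ]
  constructor
  · intro hq
    exact ⟨x, (mk0 _ _).1 hq, rfl⟩
  · rintro ⟨y, hy, hyx⟩
    rw [← hyx]
    exact (mk0 _ _).2 hy

end Ch

section EPs
variable {R : Type} [CommRing R] {X : ModuleCat.{0} R} (P : ProjectiveResolution X)

noncomputable abbrev dd (m n : ℕ) : P.complex.X m →ₗ[R] P.complex.X n := (P.complex.d m n).hom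
noncomputable def ee : P.complex.X 0 →ₗ[R] X := (P.π.f 0).hom

lemma ee_surj : Function.Surjective (ee P) :=
  (ModuleCat.epi_iff_surjective (P.π.f 0)).1 inferInstance

lemma dd_dd (m n k : ℕ) : dd P n k ∘ₗ dd P m n = 0 :=
  congrArg ModuleCat.Hom.hom (P.complex.d_comp_d m n k)

lemma ee_dd : ee P ∘ₗ dd P 1 0 = 0 :=
  congrArg ModuleCat.Hom.hom (P.complex_d_comp_π_f_zero)

lemma ex0 (x : P.complex.X 0) (h : ee P x = 0) : ∃ y, dd P 1 0 y = x :=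
  (ShortComplex.moduleCat_exact_iff _).1 P.exact₀ x h

lemma exS (n : ℕ) (x : P.complex.X (n+1)) (h : dd P (n+1) n x = 0) : ∃ y, dd P (n+2) (n+1) y = x :=
  (ShortComplex.moduleCat_exact_iff _).1 (P.exact_succ n) x h

lemma proj_lift (n : ℕ) {J C : Type} [AddCommGroup J] [Module R J]
  [AddCommGroup C] [Module R C] (g : J →ₗ[R] C) (hg : Function.Surjective g)
  (φ : P.complex.X n →ₗ[R] C) : ∃ ψ : P.complex.X n →ₗ[R] J, g ∘ₗ ψ = φ := by
  have : Module.Projective R (P.complex.X n) :=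
    (IsProjective.iff_projective (R := R) (P.complex.X n)).2 (P.projective n)
  exact Module.projective_lifting_property g φ hg

def EP (W : Type) [AddCommGroup W] [Module R W] : Prop :=
  (∀ φ : P.complex.X 0 →ₗ[R] W, φ ∘ₗ dd P 1 0 = 0 → φ = 0) ∧
  ∀ (n : ℕ) (φ : P.complex.X (n+1) →ₗ[R] W), φ ∘ₗ dd P (n+2) (n+1) = 0 →
    ∃ ψ : P.complex.X n →ₗ[R] W, φ = ψ ∘ₗ dd P (n+1) n

lemma EP_of (W : Type) [AddCommGroup W] [Module R W] (h : ∀ j : ℕ,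
      Subsingleton (((Ext R (ModuleCat R) j).obj (Opposite.op X)).obj
        (ModuleCat.of R W))) : EP P W := by
  constructor
  · intro φ hφ
    have := h 0
    obtain ⟨ψ, hψ⟩ := clsM_zero P 0 (ModuleCat.of R W) ⟨φ, hφ⟩ (Subsingleton.elim _ _) 0 (by simp)
    have h0 : P.complex.d 0 0 = 0 := P.complex.shape _ _ (by simp)
    change φ = _ at hψ
    rw [hψ, h0]
    ext x
    simp
  · intro n φ hφ
    have := h (n+1)
    exact clsM_zero P (n+1) (ModuleCat.of R W) ⟨φ, hφ⟩ (Subsingleton.elim _ _) n (by simp)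

variable {I : Ideal R} (P : ProjectiveResolution (ModuleCat.of R (R ⧸ I)))
variable {W : Type} [AddCommGroup W] [Module R W]

lemma EP_free (h : EP P W) (q : W) (hq : ∀ r ∈ I, r • q = 0) : q = 0 := by
  let u : (R ⧸ I) →ₗ[R] W := Submodule.liftQ I (LinearMap.toSpanSingleton R W q) (by
    intro r hr
    exact hq r hr)
  have h1 := h.1 (u ∘ₗ ee P) (by rw [LinearMap.comp_assoc, ee_dd, LinearMap.comp_zero])
  obtain ⟨p, hp⟩ := ee_surj P (Submodule.mkQ I 1 : R ⧸ I)
  have h2 := congrArg (fun f => f p) h1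
  simp only [LinearMap.comp_apply] at h2
  rw [hp] at h2
  have h3 : u (Submodule.mkQ I 1) = (1 : R) • q := rfl
  rw [h3, one_smul] at h2
  exact h2

lemma EP_inj (hW : Module.Injective R W) (hI : ∀ q : W, (∀ r ∈ I, r • q = 0) → q = 0) : EP P W := by
  constructor
  · intro φ hφ
    ext x
    apply hI
    intro r hr
    obtain ⟨y, hy⟩ := ex0 P (r • x) (by
      rw [map_smul]
      obtain ⟨z, hz⟩ := Submodule.mkQ_surjective I (ee P x)
      rw [← hz, ← map_smul]
      exact (mk0 I _).2 (Ideal.mul_mem_right _ _ hr))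
    rw [← map_smul, ← hy]
    exact congrArg (fun f => f y) hφ
  · intro n φ hφ
    obtain ⟨b, hb⟩ := inj_ext hW (dd P (n+1) n) φ (by
      intro x hx
      obtain ⟨y, rfl⟩ := exS P n x hx
      exact congrArg (fun f => f y) hφ)
    exact ⟨b, hb.symm⟩

lemma EP_ses (P : ProjectiveResolution X) {Q W1 : Type} [AddCommGroup Q] [Module R Q] [AddCommGroup W1] [Module R W1]
    (f : W →ₗ[R] Q) (g : Q →ₗ[R] W1) (hf : Function.Injective f) (hg : Function.Surjective g)
    (hfg : Function.Exact f g) (hW : EP P W) (hQ : EP P Q) : EP P W1 := by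
  have gf : g ∘ₗ f = 0 := hfg.linearMap_comp_eq_zero
  have key : ∀ (n : ℕ) (φ : P.complex.X n →ₗ[R] W1), φ ∘ₗ dd P (n+1) n = 0 →
      ∃ θ : P.complex.X n →ₗ[R] Q, g ∘ₗ θ = φ ∧ θ ∘ₗ dd P (n+1) n = 0 := by
    intro n φ hφ
    obtain ⟨φ', rfl⟩ := proj_lift P n g hg φ
    obtain ⟨χ, hχ⟩ := ker_factor hf hfg (φ' ∘ₗ dd P (n+1) n) hφ
    obtain ⟨ω, rfl⟩ := hW.2 n χ (by
      have : f ∘ₗ (χ ∘ₗ dd P (n+2) (n+1)) = 0 := by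
        rw [← LinearMap.comp_assoc, hχ, LinearMap.comp_assoc, dd_dd, LinearMap.comp_zero]
      ext x
      apply hf
      have := congrArg (fun f => f x) this
      simpa using this)
    refine ⟨φ' - f ∘ₗ ω, ?_, ?_⟩
    · rw [LinearMap.comp_sub, ← LinearMap.comp_assoc, gf]; simp
    · rw [LinearMap.sub_comp, ← hχ, LinearMap.comp_assoc, sub_self]
  constructor
  · intro φ hφ
    obtain ⟨θ, rfl, h⟩ := key 0 φ hφ
    rw [hQ.1 θ h, LinearMap.comp_zero]
  · intro n φ hφ
    obtain ⟨θ, rfl, h⟩ := key (n+1) φ hφ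
    obtain ⟨ψ, rfl⟩ := hQ.2 n θ h
    exact ⟨g ∘ₗ ψ, rfl⟩

lemma van_ep [IsNoetherianRing R] {S : Type} [Fintype S] [DecidableEq S] (B : Matrix S S R) (w : S → ℤ)
    (hH : Homog B w) (hBB : B * B = 0) (hw : ∀ s, w s ≤ 0)
    (hh : ∀ x ∈ I, ∃ h : Matrix S S R, B * h + h * B = x • (1 : Matrix S S R))
    (P : ProjectiveResolution (ModuleCat.of R (R ⧸ I))) (m : ℕ) :
    ∀ (j : ℤ) (_ : 0 < j + m) (W : Type) [AddCommGroup W] [Module R W] (_ : EP P W), Van B w j W := by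
  induction m with
  | zero =>
    intro j hj W _ _ _ c hc _
    refine ⟨0, ?_⟩
    rw [map_zero]
    ext s
    rw [hc s]; rfl
    have := hw s
    simp at hj
    omega
  | succ m ih =>
    intro j hj W _ _ hW
    obtain ⟨J, _, _, f, hJ, hf⟩ := enough (R := R) W
    have hQ := Q_inj (I := I) hJ
    have hQf := Q_free (I := I) (X := J)
    let φ : W →ₗ[R] (J ⧸ Gam I J) := (Gam I J).mkQ ∘ₗ f
    have hpow : ∀ k : ℕ, ∀ q : W, (∀ r ∈ I ^ k, r • q = 0) → q = 0 := by
      intro k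
      induction k with
      | zero => intro q hq; simpa using hq 1 (by simp)
      | succ k ihk =>
        intro q hq
        apply EP_free P hW
        intro r hr
        apply ihk
        intro s hs
        rw [smul_smul]
        apply hq
        rw [pow_succ]
        exact Ideal.mul_mem_mul hs hr
    have hφ : Function.Injective φ := by
      rw [injective_iff_map_eq_zero]
      intro x hx
      obtain ⟨k, hk⟩ : f x ∈ Gam I J := (mk0 _ _).1 hx
      apply hpow k
      intro r hr
      apply hf
      rw [map_smul, hk r hr, map_zero]
    have hex : Function.Exact φ (LinearMap.range φ).mkQ := LinearMap.exact_map_mkQ_range φ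
    have hs := Submodule.mkQ_surjective (LinearMap.range φ)
    refine van_left hH hBB φ (LinearMap.range φ).mkQ hφ hs hex (ih (j+1) ?_ _ ?_) (van_inj I B w hh hQ hQf j)
    · push_cast at hj; omega
    · exact EP_ses P φ _ hφ hs hex hW (EP_inj P hQ hQf)

end EPs
end Kz

open CategoryTheory

namespace Kz
section Sh
variable {R : Type} [CommRing R]
variable {A J C : Type} [AddCommGroup A] [Module R A] [AddCommGroup J] [Module R J]
  [AddCommGroup C] [Module R C] (f : A →ₗ[R] J) (g : J →ₗ[R] C)
variable {X : ModuleCat.{0} R} (P : ProjectiveResolution X)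

/-- descend along a surjection -/
noncomputable def dsc {V E F : Type} [AddCommGroup V] [Module R V] [AddCommGroup E] [Module R E]
    [AddCommGroup F] [Module R F] (u : V →ₗ[R] E) (hu : Function.Surjective u) (v : V →ₗ[R] F)
    (h : ∀ x, u x = 0 → v x = 0) : E →ₗ[R] F :=
  (Submodule.liftQ _ v (fun x hx => h x hx)) ∘ₗ (u.quotKerEquivOfSurjective hu).symm.toLinearMap

lemma dsc_apply {V E F : Type} [AddCommGroup V] [Module R V] [AddCommGroup E] [Module R E]
    [AddCommGroup F] [Module R F] (u : V →ₗ[R] E) (hu : Function.Surjective u) (v : V →ₗ[R] F)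
    (h : ∀ x, u x = 0 → v x = 0) (x : V) : dsc u hu v h (u x) = v x := by
  have : (u.quotKerEquivOfSurjective hu).symm (u x) = (LinearMap.ker u).mkQ x := by
    rw [LinearEquiv.symm_apply_eq]; rfl
  simp only [dsc, LinearMap.comp_apply, LinearEquiv.coe_coe]
  rw [this]
  rfl

/-- triples -/
def VV (j : ℕ) : Submodule R ((P.complex.X j →ₗ[R] J) × Zc P j (ModuleCat.of R C) ×
    Zc P (j+1) (ModuleCat.of R A)) where
  carrier := {v | g ∘ₗ v.1 = (v.2.1.1 : P.complex.X j →ₗ[R] C) ∧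
    f ∘ₗ (v.2.2.1 : P.complex.X (j+1) →ₗ[R] A) = v.1 ∘ₗ dd P (j+1) j}
  zero_mem' := ⟨LinearMap.comp_zero _, (LinearMap.comp_zero _).trans (LinearMap.zero_comp _).symm⟩
  add_mem' := by
    rintro a b ⟨h1, h2⟩ ⟨h3, h4⟩
    constructor
    · ext x
      have e1 := congrArg (fun f => f x) h1
      have e2 := congrArg (fun f => f x) h3
      exact (map_add g _ _).trans (congrArg₂ (· + ·) e1 e2)
    · ext x
      have e1 := congrArg (fun f => f x) h2
      have e2 := congrArg (fun f => f x) h4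
      exact (map_add f _ _).trans (congrArg₂ (· + ·) e1 e2)
  smul_mem' := by
    rintro r a ⟨h1, h2⟩
    constructor
    · ext x
      have e1 := congrArg (fun f => f x) h1
      exact (map_smul g _ _).trans (congrArg (r • ·) e1)
    · ext x
      have e1 := congrArg (fun f => f x) h2
      exact (map_smul f _ _).trans (congrArg (r • ·) e1)

/-- the type of triples -/
def VT (j : ℕ) : Type := VV f g P j
instance (j : ℕ) : AddCommGroup (VT f g P j) := inferInstanceAs (AddCommGroup (VV f g P j))
instance (j : ℕ) : Module R (VT f g P j) := inferInstanceAs (Module R (VV f g P j))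
/-- inclusion -/
def VT.incl (j : ℕ) : VT f g P j →ₗ[R] ((P.complex.X j →ₗ[R] J) × Zc P j (ModuleCat.of R C) ×
    Zc P (j+1) (ModuleCat.of R A)) := (VV f g P j).subtype

/-- first class -/
noncomputable def uu (j : ℕ) : VT f g P j →ₗ[R]
    ((Ext R (ModuleCat.{0} R) (j+1)).obj (Opposite.op X)).obj (ModuleCat.of R A) :=
  (clsM P (j+1) (ModuleCat.of R A)).hom ∘ₗ LinearMap.snd R _ _ ∘ₗ LinearMap.snd R _ _ ∘ₗ VT.incl f g P j

/-- second class -/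
noncomputable def vv (j : ℕ) : VT f g P j →ₗ[R]
    ((Ext R (ModuleCat.{0} R) j).obj (Opposite.op X)).obj (ModuleCat.of R C) :=
  (clsM P j (ModuleCat.of R C)).hom ∘ₗ LinearMap.fst R _ _ ∘ₗ LinearMap.snd R _ _ ∘ₗ VT.incl f g P j

variable {f g}
variable (hf : Function.Injective f) (hg : Function.Surjective g) (hfg : Function.Exact f g)
  (hJ : Module.Injective R J)

lemma cancelL (hf : Function.Injective f) {T : Type} [AddCommGroup T] [Module R T] {a b : T →ₗ[R] A}
    (h : f ∘ₗ a = f ∘ₗ b) : a = b := by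
  ext x
  apply hf
  exact congrArg (fun f => f x) h

lemma uu_surj (hfg : Function.Exact f g) (hJ : Module.Injective R J) (j : ℕ) : Function.Surjective (uu f g P j) := by
  intro e
  obtain ⟨χ, rfl⟩ := clsM_surj P (j+1) (ModuleCat.of R A) e
  let χ' : P.complex.X (j+1) →ₗ[R] A := χ.1
  have hχ : χ' ∘ₗ dd P (j+2) (j+1) = 0 := χ.2
  obtain ⟨ψ, hψ⟩ := inj_ext hJ (dd P (j+1) j) (f ∘ₗ χ') (by
    intro x hx
    obtain ⟨y, rfl⟩ := exS P j x hx
    have := congrArg (fun h => f (h y)) hχ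
    exact this.trans (map_zero f))
  refine ⟨⟨⟨ψ, ⟨g ∘ₗ ψ, ?_⟩, χ⟩, rfl, hψ.symm⟩, rfl⟩
  change g ∘ₗ (ψ ∘ₗ dd P (j+1) j) = 0
  rw [hψ, ← LinearMap.comp_assoc, hfg.linearMap_comp_eq_zero, LinearMap.zero_comp]

lemma vex (hf : Function.Injective f) (hfg : Function.Exact f g) (j : ℕ) (ψ : P.complex.X j →ₗ[R] J) (h : g ∘ₗ (ψ ∘ₗ dd P (j+1) j) = 0) :
    ∃ v : VT f g P j, v.1.1 = ψ := by
  obtain ⟨χ, hχ⟩ := ker_factor hf hfg _ h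
  refine ⟨⟨⟨ψ, ⟨g ∘ₗ ψ, h⟩, ⟨χ, ?_⟩⟩, rfl, hχ⟩, rfl⟩
  apply cancelL hf
  change f ∘ₗ (χ ∘ₗ dd P (j+2) (j+1)) = _
  rw [← LinearMap.comp_assoc, hχ, LinearMap.comp_assoc, dd_dd, LinearMap.comp_zero, LinearMap.comp_zero]

lemma vv_surj (hf : Function.Injective f) (hg : Function.Surjective g) (hfg : Function.Exact f g) (j : ℕ) : Function.Surjective (vv f g P j) := by
  intro e
  obtain ⟨φ, rfl⟩ := clsM_surj P j (ModuleCat.of R C) e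
  let φ' : P.complex.X j →ₗ[R] C := φ.1
  have hφ : φ' ∘ₗ dd P (j+1) j = 0 := φ.2
  obtain ⟨ψ, hψ⟩ := proj_lift P j g hg φ'
  obtain ⟨v, hv⟩ := vex P hf hfg j ψ (by rw [← LinearMap.comp_assoc, hψ, hφ])
  refine ⟨v, ?_⟩
  have : v.1.2.1 = φ := by
    apply Subtype.ext
    have := v.2.1
    rw [hv] at this
    exact this.symm.trans hψ
  change (clsM P j (ModuleCat.of R C)).hom v.1.2.1 = _
  rw [this]

/-- criterion for vanishing of uu -/
lemma uu_zero_of (hf : Function.Injective f) (j : ℕ) (v : VT f g P j) (α : P.complex.X j →ₗ[R] A)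
    (h : v.1.1 ∘ₗ dd P (j+1) j = (f ∘ₗ α) ∘ₗ dd P (j+1) j) : uu f g P j v = 0 := by
  have h1 : (v.1.2.2.1 : P.complex.X (j+1) →ₗ[R] A) = α ∘ₗ dd P (j+1) j := by
    apply cancelL hf
    rw [v.2.2, h, LinearMap.comp_assoc]
  exact clsM_bdry P (j+1) (ModuleCat.of R A) v.1.2.2 j α h1

lemma uu_zero (j : ℕ) (v : VT f g P j) (h : uu f g P j v = 0) :
    ∃ α : P.complex.X j →ₗ[R] A, (v.1.1 - f ∘ₗ α) ∘ₗ dd P (j+1) j = 0 := by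
  obtain ⟨α, hα⟩ := clsM_zero P (j+1) (ModuleCat.of R A) v.1.2.2 h j (by simp)
  refine ⟨α, ?_⟩
  have h1 : (v.1.2.2.1 : P.complex.X (j+1) →ₗ[R] A) = α ∘ₗ dd P (j+1) j := hα
  rw [LinearMap.sub_comp, ← v.2.2, h1, LinearMap.comp_assoc, sub_self]

lemma ker1 (hf : Function.Injective f) (hg : Function.Surjective g) (hfg : Function.Exact f g) (j : ℕ) : ∀ v, vv f g P (j+1) v = 0 → uu f g P (j+1) v = 0 := by
  intro v hv
  obtain ⟨ω, hω⟩ := clsM_zero P (j+1) (ModuleCat.of R C) v.1.2.1 hv j (by simp)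
  let ω1 : P.complex.X j →ₗ[R] C := ω
  have hω1 : (v.1.2.1.1 : P.complex.X (j+1) →ₗ[R] C) = ω1 ∘ₗ dd P (j+1) j := hω
  obtain ⟨ω', hω'⟩ := proj_lift P j g hg ω1
  obtain ⟨α, hα⟩ := ker_factor hf hfg (v.1.1 - ω' ∘ₗ dd P (j+1) j) (by
    rw [LinearMap.comp_sub, v.2.1, ← LinearMap.comp_assoc, hω', hω1, sub_self])
  apply uu_zero_of P hf _ v α
  rw [hα, LinearMap.sub_comp, LinearMap.comp_assoc, dd_dd, LinearMap.comp_zero, sub_zero]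

lemma ker2 (hfg : Function.Exact f g) (hJ : Module.Injective R J) (j : ℕ) : ∀ v, uu f g P (j+1) v = 0 → vv f g P (j+1) v = 0 := by
  intro v hv
  obtain ⟨α, hα⟩ := uu_zero P _ v hv
  obtain ⟨η, hη⟩ := inj_ext hJ (dd P (j+1) j) (v.1.1 - f ∘ₗ α) (by
    intro x hx
    obtain ⟨y, rfl⟩ := exS P j x hx
    exact congrArg (fun f => f y) hα)
  refine clsM_bdry P (j+1) (ModuleCat.of R C) v.1.2.1 j (g ∘ₗ η) ?_
  have h1 : (v.1.2.1.1 : P.complex.X (j+1) →ₗ[R] C) = (g ∘ₗ η) ∘ₗ dd P (j+1) j := by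
    rw [LinearMap.comp_assoc, hη, LinearMap.comp_sub, v.2.1, ← LinearMap.comp_assoc,
      hfg.linearMap_comp_eq_zero, LinearMap.zero_comp, sub_zero]
  exact h1

/-- per-object dimension shift -/
noncomputable def shm (j : ℕ) : ((Ext R (ModuleCat.{0} R) (j+1)).obj (Opposite.op X)).obj (ModuleCat.of R C) →ₗ[R]
    ((Ext R (ModuleCat.{0} R) (j+1+1)).obj (Opposite.op X)).obj (ModuleCat.of R A) :=
  dsc (vv f g P (j+1)) (vv_surj P hf hg hfg (j+1)) (uu f g P (j+1)) (ker1 P hf hg hfg j)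

lemma shm_bij (hf : Function.Injective f) (hg : Function.Surjective g) (hfg : Function.Exact f g) (hJ : Module.Injective R J) (j : ℕ) : Function.Bijective (shm P hf hg hfg j) := by
  constructor
  · rw [injective_iff_map_eq_zero]
    intro e he
    obtain ⟨v, rfl⟩ := vv_surj P hf hg hfg (j+1) e
    rw [shm, dsc_apply] at he
    exact ker2 P hfg hJ j v he
  · intro e
    obtain ⟨v, rfl⟩ := uu_surj P hfg hJ (j+1) e
    exact ⟨vv f g P (j+1) v, dsc_apply _ _ _ _ _⟩

variable {P}
/-- transport -/
lemma vtrans {X' : ModuleCat.{0} R} {P' : ProjectiveResolution X'} (i : X' ⟶ X)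
    (τ : P'.complex ⟶ P.complex) (comm : τ.f 0 ≫ P.π.f 0 = P'.π.f 0 ≫ i) (j : ℕ) (v : VT f g P j) :
    ∃ v' : VT f g P' j, v'.1.1 = v.1.1 ∘ₗ (τ.f j).hom ∧
      uu f g P' j v' = (((Ext R (ModuleCat.{0} R) (j+1)).map i.op).app (ModuleCat.of R A)).hom (uu f g P j v) ∧
      vv f g P' j v' = (((Ext R (ModuleCat.{0} R) j).map i.op).app (ModuleCat.of R C)).hom (vv f g P j v) := by
  have hc : ∀ n, (τ.f n).hom ∘ₗ dd P' (n+1) n = dd P (n+1) n ∘ₗ (τ.f (n+1)).hom := fun n =>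
    congrArg ModuleCat.Hom.hom (τ.comm (n+1) n).symm
  have hz : ∀ (n : ℕ) (Y : ModuleCat.{0} R) (φ : Zc P n Y), φ.1 ∘ₗ (τ.f n).hom ∈ Zc P' n Y := by
    intro n Y φ
    have h : φ.1 ∘ₗ dd P (n+1) n = 0 := φ.2
    change (φ.1 ∘ₗ (τ.f n).hom) ∘ₗ dd P' (n+1) n = 0
    rw [LinearMap.comp_assoc, hc, ← LinearMap.comp_assoc, h, LinearMap.zero_comp]
  refine ⟨⟨⟨v.1.1 ∘ₗ (τ.f j).hom, ⟨_, hz j _ v.1.2.1⟩, ⟨_, hz (j+1) _ v.1.2.2⟩⟩, ?_, ?_⟩, rfl, ?_, ?_⟩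
  · ext x
    have e1 := congrArg (fun f => f ((τ.f j).hom x)) v.2.1
    exact e1
  · ext x
    have e1 := congrArg (fun f => f ((τ.f (j+1)).hom x)) v.2.2
    have e2 := congrArg (fun f => v.1.1 (f x)) (hc j)
    exact e1.trans e2.symm
  · exact clsM_nat i τ comm (j+1) (ModuleCat.of R A) v.1.2.2 _ rfl
  · exact clsM_nat i τ comm j (ModuleCat.of R C) v.1.2.1 _ rfl

end Sh
end Kz

open CategoryTheory

namespace Kz
section LC
open Opposite Limits
variable {R : Type} [CommRing R] (I : Ideal R)

/-- evaluated diagram -/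
noncomputable abbrev Dg (t : ℕ) (A : Type) [AddCommGroup A] [Module R A] : (ℕᵒᵖ)ᵒᵖ ⥤ ModuleCat.{0} R :=
  localCohomology.diagram (localCohomology.idealPowersDiagram I) t ⋙ (evaluation _ _).obj (ModuleCat.of R A)

noncomputable def lcIso (t : ℕ) (A : Type) [AddCommGroup A] [Module R A] :
    (localCohomology I t).obj (ModuleCat.of R A) ≅ colimit (Dg I t A) :=
  colimitObjIsoColimitCompEvaluation (localCohomology.diagram (localCohomology.idealPowersDiagram I) t) (ModuleCat.of R A)

/-- module R/I^k -/
noncomputable abbrev NN (k : (ℕᵒᵖ)ᵒᵖ) : ModuleCat.{0} R :=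
  ((localCohomology.ringModIdeals (localCohomology.idealPowersDiagram I)).obj k.unop)

noncomputable def PP (k : (ℕᵒᵖ)ᵒᵖ) : ProjectiveResolution (NN I k) := ProjectiveResolution.of _

noncomputable abbrev NNm {k l : (ℕᵒᵖ)ᵒᵖ} (i : k ⟶ l) : NN I l ⟶ NN I k :=
  (localCohomology.ringModIdeals (localCohomology.idealPowersDiagram I)).map i.unop

noncomputable def tt {k l : (ℕᵒᵖ)ᵒᵖ} (i : k ⟶ l) : (PP I l).complex ⟶ (PP I k).complex :=
  ProjectiveResolution.lift (NNm I i) _ _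

lemma tt_comm {k l : (ℕᵒᵖ)ᵒᵖ} (i : k ⟶ l) :
    (tt I i).f 0 ≫ (PP I k).π.f 0 = (PP I l).π.f 0 ≫ NNm I i :=
  ProjectiveResolution.lift_commutes_zero _ _ _

variable {A J C : Type} [AddCommGroup A] [Module R A] [AddCommGroup J] [Module R J]
  [AddCommGroup C] [Module R C] {f : A →ₗ[R] J} {g : J →ₗ[R] C}
variable (hf : Function.Injective f) (hg : Function.Surjective g) (hfg : Function.Exact f g)
  (hJ : Module.Injective R J)

noncomputable def shNat (j : ℕ) : Dg I (j+1) C ⟶ Dg I (j+1+1) A where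
  app k := ModuleCat.ofHom (shm (PP I k) hf hg hfg j)
  naturality k l i := by
    ext e
    obtain ⟨v, rfl⟩ := vv_surj (PP I k) hf hg hfg (j+1) e
    obtain ⟨v', -, h1, h2⟩ := vtrans (NNm I i) (tt I i) (tt_comm I i) (j+1) v
    change shm (PP I l) hf hg hfg j ((((Ext R (ModuleCat.{0} R) (j+1)).map (NNm I i).op).app (ModuleCat.of R C)).hom
      (vv f g (PP I k) (j+1) v)) = (((Ext R (ModuleCat.{0} R) (j+1+1)).map (NNm I i).op).app (ModuleCat.of R A)).hom
      (shm (PP I k) hf hg hfg j (vv f g (PP I k) (j+1) v))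
    rw [← h2]
    have e1 : shm (PP I l) hf hg hfg j (vv f g (PP I l) (j+1) v') = uu f g (PP I l) (j+1) v' :=
      dsc_apply _ _ _ _ _
    have e2 : shm (PP I k) hf hg hfg j (vv f g (PP I k) (j+1) v) = uu f g (PP I k) (j+1) v :=
      dsc_apply _ _ _ _ _
    rw [e1, e2, h1]

lemma lc_shift (hf : Function.Injective f) (hg : Function.Surjective g) (hfg : Function.Exact f g) (hJ : Module.Injective R J) (j : ℕ) : Nonempty (((localCohomology I (j+1)).obj (ModuleCat.of R C)) ≃ₗ[R]
    ((localCohomology I (j+1+1)).obj (ModuleCat.of R A))) := by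
  have : ∀ k, IsIso ((shNat I hf hg hfg j).app k) := by
    intro k
    exact (ConcreteCategory.isIso_iff_bijective _).2 (shm_bij (PP I k) hf hg hfg hJ j)
  have : IsIso (shNat I hf hg hfg j) := NatIso.isIso_of_isIso_app _
  exact ⟨(lcIso I (j+1) C ≪≫ HasColimit.isoOfNatIso (asIso (shNat I hf hg hfg j)) ≪≫
    (lcIso I (j+1+1) A).symm).toLinearEquiv⟩

/-- generator -/
noncomputable def on (k : (ℕᵒᵖ)ᵒᵖ) : NN I k := (Submodule.mkQ (I ^ k.unop.unop) 1 : R ⧸ I ^ k.unop.unop)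

lemma on_map {k l : (ℕᵒᵖ)ᵒᵖ} (i : k ⟶ l) : (NNm I i).hom (on I l) = on I k := rfl

lemma on_gen (k : (ℕᵒᵖ)ᵒᵖ) (x : NN I k) : ∃ r : R, x = r • on I k := by
  obtain ⟨r, rfl⟩ := Submodule.mkQ_surjective (I ^ k.unop.unop) x
  refine ⟨r, ?_⟩
  change _ = r • Submodule.mkQ (I ^ k.unop.unop) 1
  rw [← map_smul, smul_eq_mul, mul_one]

lemma on_kill (k : (ℕᵒᵖ)ᵒᵖ) (r : R) (hr : r ∈ I ^ k.unop.unop) : r • on I k = 0 := by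
  change r • Submodule.mkQ (I ^ k.unop.unop) 1 = 0
  rw [← map_smul, smul_eq_mul, mul_one]
  exact (mk0 _ _).2 hr

lemma on_lift (k : (ℕᵒᵖ)ᵒᵖ) {W : Type} [AddCommGroup W] [Module R W] (c : W) (hc : ∀ r ∈ I ^ k.unop.unop, r • c = 0) :
    ∃ b : NN I k →ₗ[R] W, b (on I k) = c :=
  ⟨Submodule.liftQ (I ^ k.unop.unop) (LinearMap.toSpanSingleton R W c) (fun r hr => hc r hr), one_smul R c⟩

noncomputable def pp (k : (ℕᵒᵖ)ᵒᵖ) : (PP I k).complex.X 0 := (ee_surj (PP I k) (on I k)).choose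
lemma ee_pp (k : (ℕᵒᵖ)ᵒᵖ) : ee (PP I k) (pp I k) = on I k := (ee_surj (PP I k) (on I k)).choose_spec

/-- maps vanishing on boundaries depend only on the augmentation -/
lemma eqv {X : ModuleCat.{0} R} (P : ProjectiveResolution X) {W : Type} [AddCommGroup W] [Module R W]
    (φ : P.complex.X 0 →ₗ[R] W) (hφ : φ ∘ₗ dd P 1 0 = 0) (x y : P.complex.X 0) (h : ee P x = ee P y) : φ x = φ y := by
  obtain ⟨z, hz⟩ := ex0 P (x - y) (by rw [map_sub, h, sub_self])
  have := congrArg (fun f => f z) hφ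
  simp only [LinearMap.comp_apply] at this
  rw [hz, map_sub] at this
  exact sub_eq_zero.1 this

lemma kill_pp (k : (ℕᵒᵖ)ᵒᵖ) {W : Type} [AddCommGroup W] [Module R W]
    (φ : (PP I k).complex.X 0 →ₗ[R] W) (hφ : φ ∘ₗ dd (PP I k) 1 0 = 0) (r : R) (hr : r ∈ I ^ k.unop.unop) :
    r • φ (pp I k) = 0 := by
  rw [← map_smul, ← map_zero φ]
  apply eqv _ φ hφ
  rw [map_smul, ee_pp, on_kill I k r hr, map_zero]

lemma zero_of_pp (k : (ℕᵒᵖ)ᵒᵖ) {W : Type} [AddCommGroup W] [Module R W]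
    (φ : (PP I k).complex.X 0 →ₗ[R] W) (hφ : φ ∘ₗ dd (PP I k) 1 0 = 0) (h : φ (pp I k) = 0) : φ = 0 := by
  ext x
  obtain ⟨r, hr⟩ := on_gen I k (ee _ x)
  have := eqv _ φ hφ x (r • pp I k) (by rw [map_smul, ee_pp, hr])
  rw [this, map_smul, h, smul_zero]; rfl

/-- the C-part -/
lemma gψ {X : ModuleCat.{0} R} {P : ProjectiveResolution X} (v : VT f g P 0) : (g ∘ₗ v.1.1) ∘ₗ dd P 1 0 = 0 := by
  rw [v.2.1]
  exact v.1.2.1.2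

/-- evaluation at generator, in L -/
noncomputable def ww (k : (ℕᵒᵖ)ᵒᵖ) : VT f g (PP I k) 0 →ₗ[R] (C ⧸ (Gam I J).map g) :=
  Submodule.mkQ _ ∘ₗ g ∘ₗ (LinearMap.applyₗ (pp I k)) ∘ₗ LinearMap.fst R _ _ ∘ₗ VT.incl f g (PP I k) 0

lemma ww_apply (k : (ℕᵒᵖ)ᵒᵖ) (v : VT f g (PP I k) 0) : ww I k v = Submodule.mkQ _ (g (v.1.1 (pp I k))) := rfl

lemma ker3 (hfg : Function.Exact f g) (k : (ℕᵒᵖ)ᵒᵖ) : ∀ v, uu f g (PP I k) 0 v = 0 → ww I k v = 0 := by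
  intro v hv
  obtain ⟨α, hα⟩ := uu_zero (PP I k) _ v hv
  rw [ww_apply, mk0]
  refine ⟨(v.1.1 - f ∘ₗ α) (pp I k), ⟨_, kill_pp I k _ hα⟩, ?_⟩
  simp [hfg.apply_apply_eq_zero]

noncomputable def thk (k : (ℕᵒᵖ)ᵒᵖ) :
    ((Ext R (ModuleCat.{0} R) 1).obj (Opposite.op (NN I k))).obj (ModuleCat.of R A) →ₗ[R] (C ⧸ (Gam I J).map g) :=
  dsc (uu f g (PP I k) 0) (uu_surj (PP I k) hfg hJ 0) (ww I k) (ker3 I hfg k)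

lemma thk_uu (k : (ℕᵒᵖ)ᵒᵖ) (v : VT f g (PP I k) 0) : thk I hfg hJ k (uu f g (PP I k) 0 v) = ww I k v :=
  dsc_apply _ _ _ _ _

lemma vtr {k l : (ℕᵒᵖ)ᵒᵖ} (i : k ⟶ l) (v : VT f g (PP I k) 0) : ∃ v' : VT f g (PP I l) 0,
    uu f g (PP I l) 0 v' = (((Ext R (ModuleCat.{0} R) 1).map (NNm I i).op).app (ModuleCat.of R A)).hom (uu f g (PP I k) 0 v)
    ∧ g (v'.1.1 (pp I l)) = g (v.1.1 (pp I k)) := by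
  obtain ⟨v', h0, h1, -⟩ := vtrans (NNm I i) (tt I i) (tt_comm I i) 0 v
  refine ⟨v', h1, ?_⟩
  rw [h0]
  apply eqv (PP I k) (g ∘ₗ v.1.1) (gψ v)
  have := congrArg (fun f => f.hom (pp I l)) (tt_comm I i)
  have h2 : ee (PP I k) (((tt I i).f 0).hom (pp I l)) = (NNm I i).hom (ee (PP I l) (pp I l)) := this
  rw [h2, ee_pp, ee_pp, on_map]

noncomputable def thC : Cocone (Dg I 1 A) where
  pt := ModuleCat.of R (C ⧸ (Gam I J).map g)
  ι :=
    { app := fun k => ModuleCat.ofHom (thk I hfg hJ k)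
      naturality := by
        intro k l i
        ext e
        obtain ⟨v, rfl⟩ := uu_surj (PP I k) hfg hJ 0 e
        obtain ⟨v', h1, h2⟩ := vtr I i v
        change thk I hfg hJ l ((((Ext R (ModuleCat.{0} R) 1).map (NNm I i).op).app (ModuleCat.of R A)).hom (uu f g (PP I k) 0 v))
          = thk I hfg hJ k (uu f g (PP I k) 0 v)
        rw [← h1, thk_uu, thk_uu, ww_apply, ww_apply, h2] }

noncomputable def TH : colimit (Dg I 1 A) ⟶ ModuleCat.of R (C ⧸ (Gam I J).map g) :=
  colimit.desc _ (thC I hfg hJ)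

lemma TH_ι (k : (ℕᵒᵖ)ᵒᵖ) (v : VT f g (PP I k) 0) :
    (TH I hfg hJ).hom ((colimit.ι (Dg I 1 A) k).hom (uu f g (PP I k) 0 v)) = Submodule.mkQ _ (g (v.1.1 (pp I k))) := by
  have := colimit.ι_desc (thC I hfg hJ) k
  have h2 := congrArg (fun m => m.hom (uu f g (PP I k) 0 v)) this
  exact h2.trans (thk_uu I hfg hJ k v)

lemma rep (hfg : Function.Exact f g) (hJ : Module.Injective R J) (x : (colimit (Dg I 1 A) : ModuleCat.{0} R)) : ∃ (k : (ℕᵒᵖ)ᵒᵖ) (v : VT f g (PP I k) 0),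
    x = (colimit.ι (Dg I 1 A) k).hom (uu f g (PP I k) 0 v) := by
  obtain ⟨k, e, he⟩ := Concrete.colimit_exists_rep (Dg I 1 A) x
  obtain ⟨v, rfl⟩ := uu_surj (PP I k) hfg hJ 0 e
  exact ⟨k, v, he.symm⟩

lemma TH_inj (hf : Function.Injective f) (hfg : Function.Exact f g) (hJ : Module.Injective R J) : Function.Injective (TH I hfg hJ).hom := by
  rw [injective_iff_map_eq_zero]
  intro x hx
  obtain ⟨k, v, rfl⟩ := rep I hfg hJ x
  rw [TH_ι, mk0] at hx
  obtain ⟨γ, ⟨l, hl⟩, hγ⟩ := hx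
  let m : (ℕᵒᵖ)ᵒᵖ := op (op (max k.unop.unop l))
  let i : k ⟶ m := (homOfLE (le_max_left k.unop.unop l)).op.op
  obtain ⟨v', h1, h2⟩ := vtr I i v
  have h3 : (colimit.ι (Dg I 1 A) k).hom (uu f g (PP I k) 0 v) =
      (colimit.ι (Dg I 1 A) m).hom (uu f g (PP I m) 0 v') := by
    rw [h1]
    have := congrArg (fun m => m.hom (uu f g (PP I k) 0 v)) (colimit.w (Dg I 1 A) i)
    exact this.symm
  rw [h3]
  have h4 : uu f g (PP I m) 0 v' = 0 := by
    obtain ⟨b, hb⟩ := on_lift I m γ (fun r hr => hl r (Ideal.pow_le_pow_right (le_max_right _ _) hr))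
    have hbd : (b ∘ₗ ee (PP I m)) ∘ₗ dd (PP I m) 1 0 = 0 := by
      rw [LinearMap.comp_assoc, ee_dd, LinearMap.comp_zero]
    have h5 : g ∘ₗ (v'.1.1 - b ∘ₗ ee (PP I m)) = 0 := by
      apply zero_of_pp I m
      · rw [LinearMap.comp_sub, LinearMap.sub_comp, gψ, LinearMap.comp_assoc (dd (PP I m) 1 0) (b ∘ₗ ee (PP I m)) g, hbd, LinearMap.comp_zero, sub_zero]
      · simp only [LinearMap.comp_apply, LinearMap.sub_apply, map_sub]
        rw [ee_pp, hb, h2, hγ, sub_self]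
    obtain ⟨α, hα⟩ := ker_factor hf hfg _ h5
    apply uu_zero_of (PP I m) hf 0 v' α
    rw [hα, LinearMap.sub_comp, hbd, sub_zero]
  rw [h4]; exact map_zero _

lemma TH_range (hf : Function.Injective f) (hg : Function.Surjective g) (hfg : Function.Exact f g) (hJ : Module.Injective R J) : LinearMap.range (TH I hfg hJ).hom = (Gam I C).map (Submodule.mkQ _) := by
  apply le_antisymm
  · rintro _ ⟨x, rfl⟩
    obtain ⟨k, v, rfl⟩ := rep I hfg hJ x
    rw [TH_ι]
    exact ⟨_, ⟨_, kill_pp I k _ (gψ v)⟩, rfl⟩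
  · rintro _ ⟨c, ⟨l, hl⟩, rfl⟩
    let k : (ℕᵒᵖ)ᵒᵖ := op (op l)
    obtain ⟨b, hb⟩ := on_lift I k c hl
    obtain ⟨ψ, hψ⟩ := proj_lift (PP I k) 0 g hg (b ∘ₗ ee (PP I k))
    obtain ⟨v, hv⟩ := vex (PP I k) hf hfg 0 ψ (by
      rw [← LinearMap.comp_assoc, hψ, LinearMap.comp_assoc, ee_dd, LinearMap.comp_zero])
    refine ⟨(colimit.ι (Dg I 1 A) k).hom (uu f g (PP I k) 0 v), ?_⟩
    rw [TH_ι, hv]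
    have := congrArg (fun f => f (pp I k)) hψ
    simp only [LinearMap.comp_apply] at this
    rw [this, ee_pp, hb]

lemma lc_one (hf : Function.Injective f) (hg : Function.Surjective g) (hfg : Function.Exact f g) (hJ : Module.Injective R J) : ∃ Θ : ((localCohomology I 1).obj (ModuleCat.of R A)) →ₗ[R] (C ⧸ (Gam I J).map g),
    Function.Injective Θ ∧ LinearMap.range Θ = (Gam I C).map (Submodule.mkQ _) := by
  let e := (lcIso I 1 A).toLinearEquiv
  refine ⟨(TH I hfg hJ).hom ∘ₗ e.toLinearMap, (TH_inj I hf hfg hJ).comp e.injective, ?_⟩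
  rw [← TH_range I hf hg hfg hJ]
  exact LinearMap.range_comp_of_range_eq_top _ (LinearEquiv.range e)

end LC
end Kz

open CategoryTheory

namespace Kz
section Fin
variable {R : Type} [CommRing R] [IsNoetherianRing R] (I : Ideal R)
variable {S : Type} [Fintype S] [DecidableEq S] {A : Matrix S S R} {w : S → ℤ}

noncomputable abbrev HH (t : ℕ) (X : Type) [AddCommGroup X] [Module R X] : ModuleCat.{0} R :=
  (localCohomology I t).obj (ModuleCat.of R X)

lemma ses (X : Type) [AddCommGroup X] [Module R X] :
    ∃ (J : Type) (_ : AddCommGroup J) (_ : Module R J) (C : Type) (_ : AddCommGroup C)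
      (_ : Module R C) (f : X →ₗ[R] J) (g : J →ₗ[R] C), Module.Injective R J ∧
      Function.Injective f ∧ Function.Surjective g ∧ Function.Exact f g := by
  obtain ⟨J, _, _, f, hJ, hf⟩ := enough (R := R) X
  exact ⟨J, inferInstance, inferInstance, J ⧸ LinearMap.range f, inferInstance, inferInstance,
    f, (LinearMap.range f).mkQ, hJ, hf, Submodule.mkQ_surjective _, LinearMap.exact_map_mkQ_range f⟩

lemma lemX (hAA : A * A = 0) (hH : Homog A w)
    (hh : ∀ x ∈ I, ∃ h : Matrix S S R, A * h + h * A = x • (1 : Matrix S S R)) (m : ℕ) :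
    ∀ (j : ℤ) (_ : ∀ s, w s < j + m) (X : Type) [AddCommGroup X] [Module R X]
      (_ : ∀ t : ℕ, ∀ i, Van A w i (HH I (t + 1) X)), Van A w j (X ⧸ Gam I X) := by
  induction m with
  | zero =>
    intro j hj X _ _ _ c hc _
    refine ⟨0, ?_⟩
    rw [map_zero]
    ext s
    exact (hc s (by have := hj s; simp at this; omega)).symm
  | succ m ih =>
    intro j hj X _ _ hX
    obtain ⟨J, _, _, C, _, _, f, g, hJ, hf, hg, hfg⟩ := ses (R := R) X
    have hC : Van A w (j + 1) (C ⧸ Gam I C) := by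
      apply ih
      · intro s; have := hj s; push_cast at this; omega
      · intro t i
        obtain ⟨e⟩ := lc_shift I hf hg hfg hJ t
        exact van_iso e.symm (hX (t + 1) i)
    obtain ⟨Θ, hΘ, hr⟩ := lc_one I hf hg hfg hJ
    have hL := van_mid hH hAA Θ (dmap I g) hΘ (dmap_surj I) (d_exact I Θ hr) (hX 0 (j + 1)) hC
    exact van_left hH hAA (qmap I f) (lmap I g) (qmap_inj I hf) (lmap_surj I hg) (ql_exact I hfg) hL
      (van_inj I A w hh (Q_inj (I := I) hJ) (Q_free (I := I) (X := J)) j)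

lemma lemY (hAA : A * A = 0) (hH : Homog A w) (hw : ∀ s, 0 ≤ w s)
    (hh : ∀ x ∈ I, ∃ h : Matrix S S R, A * h + h * A = x • (1 : Matrix S S R))
    (X : Type) [AddCommGroup X] [Module R X]
    (hX : ∀ t : ℕ, ∀ i, Van A w i (HH I (t + 1 + 1) X)) : Van A w 0 (HH I 1 X) := by
  obtain ⟨J, _, _, C, _, _, f, g, hJ, hf, hg, hfg⟩ := ses (R := R) X
  have hC : Van A w (0 + 1) (C ⧸ Gam I C) := by
    apply lemX I hAA hH hh (∑ s, w s).toNat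
    · intro s
      have h1 : w s ≤ ∑ s, w s :=
        Finset.single_le_sum (fun s _ => hw s) (Finset.mem_univ s)
      omega
    · intro t i
      obtain ⟨e⟩ := lc_shift I hf hg hfg hJ t
      exact van_iso e.symm (hX t i)
  obtain ⟨Θ, hΘ, hr⟩ := lc_one I hf hg hfg hJ
  have hL : Van A w 0 (C ⧸ (Gam I J).map g) := van_zero_surj hw hH (lmap I g) (lmap_surj I hg)
    (van_inj I A w hh (Q_inj (I := I) hJ) (Q_free (I := I) (X := J)) 0)
  exact van_left hH hAA Θ (dmap I g) hΘ (dmap_surj I) (d_exact I Θ hr) hC hL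

lemma lemZ (hAA : A * A = 0) (hH : Homog A w) (hw : ∀ s, 0 ≤ w s)
    (hh : ∀ x ∈ I, ∃ h : Matrix S S R, A * h + h * A = x • (1 : Matrix S S R)) (n : ℕ) :
    ∀ (X : Type) [AddCommGroup X] [Module R X]
      (_ : ∀ t : ℕ, n + 1 < t → ∀ i, Van A w i (HH I t X)), Van A w 0 (HH I (n + 1) X) := by
  induction n with
  | zero =>
    intro X _ _ hX
    exact lemY I hAA hH hw hh X (fun t i => hX _ (by omega) i)
  | succ n ih =>
    intro X _ _ hX
    obtain ⟨J, _, _, C, _, _, f, g, hJ, hf, hg, hfg⟩ := ses (R := R) X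
    obtain ⟨e⟩ := lc_shift I hf hg hfg hJ n
    refine van_iso e (ih C ?_)
    intro t ht i
    obtain ⟨t, rfl⟩ : ∃ k, t = k + 1 := ⟨t - 1, by omega⟩
    obtain ⟨e⟩ := lc_shift I hf hg hfg hJ t
    exact van_iso e.symm (hX (t + 1 + 1) (by omega) i)

lemma van_of_ext (hAA : A * A = 0) (hH : Homog A w) (hw : ∀ s, 0 ≤ w s)
    (hh : ∀ x ∈ I, ∃ h : Matrix S S R, A * h + h * A = x • (1 : Matrix S S R))
    {E : Type} [AddCommGroup E] [Module R E] (hE : Cogen R E)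
    (X : Type) [AddCommGroup X] [Module R X]
    (hX : ∀ j : ℕ, Subsingleton (((Ext R (ModuleCat R) j).obj
        (Opposite.op (ModuleCat.of R (R ⧸ I)))).obj (ModuleCat.of R (X →ₗ[R] E)))) (j : ℤ) :
    Van A w j X := by
  apply van_dual A w hH hE
  intro j
  apply van_ep (I := I) A.transpose (fun s => - w s) hH.transpose
    (by rw [← Matrix.transpose_mul, hAA, Matrix.transpose_zero])
    (fun s => by have := hw s; simp; omega) ?_ (ProjectiveResolution.of _) (1 - j).toNat j
    (by omega) _ (EP_of _ _ hX)
  intro x hx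
  obtain ⟨h, h1⟩ := hh x hx
  refine ⟨h.transpose, ?_⟩
  rw [← Matrix.transpose_mul, ← Matrix.transpose_mul, ← Matrix.transpose_add, add_comm, h1]
  simp

lemma fin (hH : Homog A w) (hw : ∀ s, 0 ≤ w s) (hs : ∃ s, w s = 0) (hA : ∀ s t, A s t ∈ I)
    {E : Type} [AddCommGroup E] [Module R E] (X : Type) [AddCommGroup X] [Module R X]
    (hX : Van A w 0 X) : Subsingleton ((R ⧸ I) →ₗ[R] (X →ₗ[R] E)) := by
  obtain ⟨s0, hs0⟩ := hs
  have key : ∀ φ : (R ⧸ I) →ₗ[R] (X →ₗ[R] E), φ = 0 := by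
    intro φ
    apply Submodule.linearMap_qext
    ext x
    obtain ⟨b, hb⟩ := hX (Pi.single s0 x) (by
        intro s hs
        apply Pi.single_eq_of_ne
        rintro rfl; exact hs hs0) (by
        ext s
        rw [mact_apply]
        apply Finset.sum_eq_zero
        intro t _
        by_cases hA : A s t = 0
        · simp [hA]
        · have h1 := hH s t hA
          have h2 := hw s
          rw [Pi.single_eq_of_ne, smul_zero]
          rintro rfl; omega)
    have h1 := congrFun hb s0
    rw [Pi.single_eq_same, mact_apply] at h1
    simp only [LinearMap.comp_apply, LinearMap.zero_apply]
    rw [← h1, map_sum]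
    apply Finset.sum_eq_zero
    intro t _
    rw [map_smul, ← LinearMap.smul_apply, ← map_smul, ← map_smul, (mk0 _ _).2, map_zero,
      LinearMap.zero_apply]
    simpa using hA s0 t
  exact ⟨fun a b => by rw [key a, key b]⟩

open DirectSum in
theorem main {R : Type} [CommRing R] [IsNoetherianRing R]
    (𝔞 : Ideal R)
    (M : Type) [AddCommGroup M] [Module R M]
    (E : Type) [AddCommGroup E] [Module R E]
    (f : (⨁ m : MaximalSpectrum R, R ⧸ m.asIdeal) →ₗ[R] E) (hE : Module.Injective R E)
    (hf : Function.Injective f)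
    (n : ℕ) (hn : 0 < n)
    (hvanish : ∀ t, n < t → ∀ j : ℕ,
      Subsingleton (((Ext R (ModuleCat R) j).obj (Opposite.op (ModuleCat.of R (R ⧸ 𝔞)))).obj
        (ModuleCat.of R (((localCohomology 𝔞 t).obj (ModuleCat.of R M)) →ₗ[R] E)))) :
    Subsingleton
      ((R ⧸ 𝔞) →ₗ[R] (((localCohomology 𝔞 n).obj (ModuleCat.of R M)) →ₗ[R] E)) := by
  obtain ⟨S, _, _, w, A, hAA, hH, hw, hs, hA, hh⟩ := hasK 𝔞
  obtain ⟨n, rfl⟩ : ∃ k, n = k + 1 := ⟨n - 1, by omega⟩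
  apply fin 𝔞 hH hw hs hA
  exact lemZ 𝔞 hAA hH hw hh n M
    (fun t ht i => van_of_ext 𝔞 hAA hH hw hh (cogen hE f hf) _ (hvanish t ht) i)

end Fin
end Kz

open DirectSum in
/-- Lemma 2.7: if `Ext^j_R(R/𝔞, D_R(H^t_𝔞(M))) = 0` for all `t > n` and all `j ≥ 0`, then
`Hom_R(R/𝔞, D_R(H^n_𝔞(M))) = 0`; here `D_R(−) = Hom_R(−, E_R)` with `E_R` the injective hull
of the direct sum of all simple `R`-modules. -/
theorem stmt8 {R : Type} [CommRing R] [IsNoetherianRing R]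
    (𝔞 : Ideal R) (h𝔞 : 𝔞 ≠ ⊤)
    (M : Type) [AddCommGroup M] [Module R M] [Module.Finite R M]
    (E : Type) [AddCommGroup E] [Module R E]
    (f : (⨁ m : MaximalSpectrum R, R ⧸ m.asIdeal) →ₗ[R] E) (hE : IsInjectiveHull R f)
    (n : ℕ) (hn : 0 < n)
    (hvanish : ∀ t, n < t → ∀ j : ℕ,
      Subsingleton (((Ext R (ModuleCat R) j).obj (Opposite.op (ModuleCat.of R (R ⧸ 𝔞)))).obj
        (ModuleCat.of R (((localCohomology 𝔞 t).obj (ModuleCat.of R M)) →ₗ[R] E)))) :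
    Subsingleton
      ((R ⧸ 𝔞) →ₗ[R] (((localCohomology 𝔞 n).obj (ModuleCat.of R M)) →ₗ[R] E)) := by
  exact Kz.main 𝔞 M E f hE.injective hE.inj n hn hvanish
end

section
/- Let R be a Noetherian ring, 𝔞 ⊊ R a proper ideal, and M a finite RCMF module with respect to 𝔞 with cd-filtration {M_i}_{i=0}^c where c = cd(𝔞,M). Then for all 1 ≤ i ≤ c there are isomorphisms H^i_𝔞(M) ≅ H^i_𝔞(M_i) ≅ H^i_𝔞(M_i/M_{i−1}). -/
open CategoryTheory

section bridge
open Opposite Limits CategoryTheory.Abelian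

variable {R : Type} [CommRing R]

section generic
variable (K : ChainComplex (ModuleCat.{0} R)ᵒᵖ ℕ) (n : ℕ)

lemma lc_pOp_inj : Function.Injective (K.pOpcycles n).unop := by
  rw [← ModuleCat.mono_iff_injective]; infer_instance

lemma lc_iota_surj : Function.Surjective (K.homologyι n).unop := by
  rw [← ModuleCat.epi_iff_surjective]; infer_instance

lemma lc_pOp_exact (f : (K.X n).unop) (hf : (K.d (n + 1) n).unop f = 0) :
    ∃ z, (K.pOpcycles n).unop z = f := by
  have h := (ShortComplex.exact_of_g_is_cokernel
    (ShortComplex.mk _ _ (K.d_pOpcycles (n+1) n)) (K.opcyclesIsCokernel (n+1) n (by simp))).unop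
  rw [ShortComplex.moduleCat_exact_iff] at h
  exact h f hf

lemma lc_d_pOp (z : (K.opcycles n).unop) :
    (K.d (n + 1) n).unop ((K.pOpcycles n).unop z) = 0 := by
  exact congrArg (fun k => k.unop z) (K.d_pOpcycles (n+1) n)

lemma lc_iota_exact (z : (K.opcycles n).unop) (hz : (K.homologyι n).unop z = 0) (m : ℕ)
    (hm : (ComplexShape.down ℕ).next n = m) :
    ∃ g, (K.fromOpcycles n m).unop g = z := by
  have h := (ShortComplex.exact_of_f_is_kernel
    (ShortComplex.mk _ _ (K.homologyι_comp_fromOpcycles n m)) (K.homologyIsKernel n m hm)).unop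
  rw [ShortComplex.moduleCat_exact_iff] at h
  exact h z hz

lemma lc_iota_from (m : ℕ) (g : (K.X m).unop) :
    (K.homologyι n).unop ((K.fromOpcycles n m).unop g) = 0 := by
  exact congrArg (fun k => k.unop g) (K.homologyι_comp_fromOpcycles n m)

lemma lc_p_from (m : ℕ) (g : (K.X m).unop) :
    (K.pOpcycles n).unop ((K.fromOpcycles n m).unop g) = (K.d n m).unop g := by
  exact congrArg (fun k => k.unop g) (K.p_fromOpcycles n m)
end generic

variable {X Y : ModuleCat.{0} R}

abbrev lcK (P : ProjectiveResolution X) (Y : ModuleCat.{0} R) :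
    ChainComplex (ModuleCat.{0} R)ᵒᵖ ℕ :=
  ((((linearYoneda R (ModuleCat.{0} R)).obj Y).rightOp).mapHomologicalComplex
    (ComplexShape.down ℕ)).obj P.complex

noncomputable abbrev oldExt (n : ℕ) (X Y : ModuleCat.{0} R) : ModuleCat.{0} R :=
  ((Ext R (ModuleCat.{0} R) n).obj (op X)).obj Y

/-- the map from opcycles (unop) to the old `Ext`. -/
noncomputable def lcq (P : ProjectiveResolution X) (Y : ModuleCat.{0} R) (n : ℕ) :
    ((lcK P Y).opcycles n).unop ⟶ oldExt n X Y :=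
  ((P.isoLeftDerivedObj ((linearYoneda R (ModuleCat.{0} R)).obj Y).rightOp n).hom ≫
    (lcK P Y).homologyι n).unop

lemma lcq_apply (P : ProjectiveResolution X) (n : ℕ) (z) :
    lcq P Y n z = (P.isoLeftDerivedObj ((linearYoneda R (ModuleCat.{0} R)).obj Y).rightOp n).hom.unop
      (((lcK P Y).homologyι n).unop z) := rfl

lemma lcq_surj (P : ProjectiveResolution X) (n : ℕ) : Function.Surjective (lcq P Y n) := by
  intro x
  have : Epi ((P.isoLeftDerivedObj
    ((linearYoneda R (ModuleCat.{0} R)).obj Y).rightOp n).hom.unop) := inferInstance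
  obtain ⟨y, hy⟩ := (ModuleCat.epi_iff_surjective _).1 this x
  obtain ⟨z, rfl⟩ := lc_iota_surj (lcK P Y) n y
  exact ⟨z, hy⟩

lemma lcq_zero_iff (P : ProjectiveResolution X) (n : ℕ) (z) :
    lcq P Y n z = 0 ↔ ((lcK P Y).homologyι n).unop z = 0 := by
  rw [lcq_apply]
  have : Mono ((P.isoLeftDerivedObj
    ((linearYoneda R (ModuleCat.{0} R)).obj Y).rightOp n).hom.unop) := inferInstance
  exact map_eq_zero_iff _ ((ModuleCat.mono_iff_injective _).1 this)

/-- `x` is represented by the cocycle `f`. -/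
def CRep (P : ProjectiveResolution X) {n : ℕ} (x : oldExt n X Y) (f : P.complex.X n ⟶ Y) : Prop :=
  ∃ z, ((lcK P Y).pOpcycles n).unop z = f ∧ lcq P Y n z = x

lemma rep_exists (P : ProjectiveResolution X) {n : ℕ} (x : oldExt n X Y) :
    ∃ f, CRep P x f := by
  obtain ⟨z, hz⟩ := lcq_surj P n x
  exact ⟨_, z, rfl, hz⟩

lemma CRep.cocycle {P : ProjectiveResolution X} {n : ℕ} {x : oldExt n X Y} {f}
    (h : CRep P x f) : P.complex.d (n+1) n ≫ f = 0 := by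
  obtain ⟨z, rfl, hz⟩ := h
  exact lc_d_pOp (lcK P Y) n z

lemma rep_of_cocycle (P : ProjectiveResolution X) {n : ℕ} (f : P.complex.X n ⟶ Y)
    (hf : P.complex.d (n+1) n ≫ f = 0) : ∃ x : oldExt n X Y, CRep P x f := by
  obtain ⟨z, hz⟩ := lc_pOp_exact (lcK P Y) n f hf
  exact ⟨_, z, hz, rfl⟩

lemma CRep.add {P : ProjectiveResolution X} {n : ℕ} {x y : oldExt n X Y} {f g}
    (h : CRep P x f) (h' : CRep P y g) : CRep P (x + y) (f + g) := by
  obtain ⟨z, rfl, rfl⟩ := h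
  obtain ⟨w, rfl, rfl⟩ := h'
  exact ⟨z + w, map_add ((lcK P Y).pOpcycles n).unop.hom z w, map_add (lcq P Y n).hom z w⟩

lemma CRep.sub {P : ProjectiveResolution X} {n : ℕ} {x y : oldExt n X Y} {f g}
    (h : CRep P x f) (h' : CRep P y g) : CRep P (x - y) (f - g) := by
  obtain ⟨z, rfl, rfl⟩ := h
  obtain ⟨w, rfl, rfl⟩ := h'
  exact ⟨z - w, map_sub ((lcK P Y).pOpcycles n).unop.hom z w, map_sub (lcq P Y n).hom z w⟩

lemma CRep.zero_iff {P : ProjectiveResolution X} {n : ℕ} {x : oldExt n X Y} {f}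
    (h : CRep P x f) : x = 0 ↔ ∃ g, P.complex.d n ((ComplexShape.down ℕ).next n) ≫ g = f := by
  obtain ⟨z, rfl, rfl⟩ := h
  constructor
  · intro h
    rw [lcq_zero_iff] at h
    obtain ⟨g, rfl⟩ := lc_iota_exact _ _ _ h _ rfl
    exact ⟨g, (lc_p_from (lcK P Y) n _ g).symm⟩
  · rintro ⟨g, hg⟩
    have : z = ((lcK P Y).fromOpcycles n _).unop g := by
      apply lc_pOp_inj
      exact hg.symm.trans (lc_p_from (lcK P Y) n _ g).symm
    rw [this, lcq_zero_iff]
    exact lc_iota_from (lcK P Y) n _ g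

lemma extMk_zero_iff' (P : ProjectiveResolution X) {n : ℕ} (f : P.complex.X n ⟶ Y)
    (hf : P.complex.d (n+1) n ≫ f = 0) :
    P.extMk f (n+1) rfl hf = 0 ↔
      ∃ g, P.complex.d n ((ComplexShape.down ℕ).next n) ≫ g = f := by
  rcases n with _ | n
  · have h0 : P.complex.d 0 ((ComplexShape.down ℕ).next 0) = 0 := by
      apply P.complex.shape; simp
    simp only [← P.extEquivCohomologyClass.apply_eq_iff_eq,
      P.extEquivCohomologyClass_extMk, P.extEquivCohomologyClass_zero,
      CochainComplex.HomComplex.CohomologyClass.mk_eq_zero_iff, h0]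
    rw [CochainComplex.HomComplex.Cocycle.toSingleMk_mem_coboundaries_iff _ _ _ _ _ 1 (by simp)]
    have hz : P.cochainComplex.d (-(0:ℕ) : ℤ) 1 = 0 := by
      apply IsZero.eq_of_tgt
      exact CochainComplex.isZero_of_isStrictlyLE _ 0 _ (by simp)
    simp only [hz, zero_comp]
    constructor
    · rintro ⟨g, hg⟩
      refine ⟨0, ?_⟩
      rw [← cancel_epi (P.cochainComplexXIso (-(0:ℕ) : ℤ) 0 rfl).hom]
      simpa using hg
    · rintro ⟨g, hg⟩
      exact ⟨0, by rw [← hg]; simp⟩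
  · have hn : (ComplexShape.down ℕ).next (n+1) = n := by simp
    rw [hn]
    exact P.extMk_eq_zero_iff f _ rfl hf n rfl


lemma CRep.precomp {X' : ModuleCat.{0} R} {P : ProjectiveResolution X}
    {P' : ProjectiveResolution X'} {g : X' ⟶ X} (φ : ProjectiveResolution.Hom P' P g)
    {n : ℕ} {x : oldExt n X Y} {f} (h : CRep P x f) :
    CRep P' (((Ext R (ModuleCat.{0} R) n).map g.op).app Y x) (φ.hom.f n ≫ f) := by
  obtain ⟨z, rfl, rfl⟩ := h
  let F := ((linearYoneda R (ModuleCat.{0} R)).obj Y).rightOp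
  let ψ : lcK P' Y ⟶ lcK P Y := (F.mapHomologicalComplex (ComplexShape.down ℕ)).map φ.hom
  refine ⟨(HomologicalComplex.opcyclesMap ψ n).unop z, ?_, ?_⟩
  · exact congrArg (fun k => k.unop z) (HomologicalComplex.p_opcyclesMap ψ n)
  · have h1 : φ.hom.f 0 ≫ P.π.f 0 = P'.π.f 0 ≫ g := by
      simpa using φ.hom_f_zero_comp_π_f_zero
    have h2 := P'.isoLeftDerivedObj_hom_naturality g P φ.hom h1 F n
    have h3 := congrArg (fun k => k.unop z) (HomologicalComplex.homologyι_naturality ψ n)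
    have h4 := congrArg (fun k => k.unop (((lcK P Y).homologyι n).unop z)) h2
    exact (congrArg (P'.isoLeftDerivedObj F n).hom.unop h3.symm).trans h4.symm

lemma CRep.postcomp {Y' : ModuleCat.{0} R} {P : ProjectiveResolution X} (g : Y ⟶ Y')
    {n : ℕ} {x : oldExt n X Y} {f} (h : CRep P x f) :
    CRep P (((Ext R (ModuleCat.{0} R) n).obj (op X)).map g x) (f ≫ g) := by
  obtain ⟨z, rfl, rfl⟩ := h
  let F := ((linearYoneda R (ModuleCat.{0} R)).obj Y).rightOp
  let F' := ((linearYoneda R (ModuleCat.{0} R)).obj Y').rightOp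
  let α : F' ⟶ F := NatTrans.rightOp ((linearYoneda R (ModuleCat.{0} R)).map g)
  let ψ : lcK P Y' ⟶ lcK P Y := (NatTrans.mapHomologicalComplex α _).app P.complex
  refine ⟨(HomologicalComplex.opcyclesMap ψ n).unop z, ?_, ?_⟩
  · exact congrArg (fun k => k.unop z) (HomologicalComplex.p_opcyclesMap ψ n)
  · have h2 := P.leftDerived_app_eq α n
    rw [← Category.assoc, Iso.eq_comp_inv] at h2
    have h3 := congrArg (fun k => k.unop z) (HomologicalComplex.homologyι_naturality ψ n)
    have h4 := congrArg (fun k => k.unop (((lcK P Y).homologyι n).unop z)) h2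
    exact (congrArg (P.isoLeftDerivedObj F' n).hom.unop h3.symm).trans h4.symm

noncomputable def theta {n : ℕ} (x : oldExt n X Y) : Ext X Y n :=
  (projectiveResolution X).extMk (rep_exists (projectiveResolution X) x).choose (n+1) rfl
    (rep_exists (projectiveResolution X) x).choose_spec.cocycle

lemma CRep.theta {n : ℕ} {x : oldExt n X Y} {f} (h : CRep (projectiveResolution X) x f) :
    theta x = (projectiveResolution X).extMk f (n+1) rfl h.cocycle := by
  unfold _root_.theta
  rw [← sub_eq_zero, ProjectiveResolution.sub_extMk, extMk_zero_iff']
  exact ((rep_exists (projectiveResolution X) x).choose_spec.sub h).zero_iff.1 (sub_self x)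

lemma theta_add {n : ℕ} (x y : oldExt n X Y) : theta (x + y) = theta x + theta y := by
  obtain ⟨f, hf⟩ := rep_exists (projectiveResolution X) x
  obtain ⟨g, hg⟩ := rep_exists (projectiveResolution X) y
  rw [hf.theta, hg.theta, (hf.add hg).theta, ProjectiveResolution.add_extMk]

lemma theta_eq_zero_iff {n : ℕ} (x : oldExt n X Y) : theta x = 0 ↔ x = 0 := by
  obtain ⟨f, hf⟩ := rep_exists (projectiveResolution X) x
  rw [hf.theta, extMk_zero_iff', hf.zero_iff]

lemma theta_surj {n : ℕ} (y : Ext X Y n) : ∃ x : oldExt n X Y, theta x = y := by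
  obtain ⟨f, hf, rfl⟩ := (projectiveResolution X).extMk_surjective y (n+1) rfl
  obtain ⟨x, hx⟩ := rep_of_cocycle _ f hf
  exact ⟨x, hx.theta⟩

lemma theta_inj {n : ℕ} {x y : oldExt n X Y} (h : theta x = theta y) : x = y := by
  have h1 := theta_add (x - y) y
  rw [sub_add_cancel, h, right_eq_add, theta_eq_zero_iff, sub_eq_zero] at h1
  exact h1

lemma theta_precomp {X' : ModuleCat.{0} R} (g : X' ⟶ X) {n : ℕ} (x : oldExt n X Y) :
    theta (((Ext R (ModuleCat.{0} R) n).map g.op).app Y x) =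
      (Ext.mk₀ g).comp (theta x) (zero_add n) := by
  obtain ⟨f, hf⟩ := rep_exists (projectiveResolution X) x
  let φ : ProjectiveResolution.Hom (projectiveResolution X') (projectiveResolution X) g :=
    ⟨ProjectiveResolution.lift g _ _, by
      simpa using ProjectiveResolution.lift_commutes_zero g _ _⟩
  rw [hf.theta, (hf.precomp φ).theta, ProjectiveResolution.mk₀_comp_extMk _ _ _ _ φ]

lemma theta_postcomp {Y' : ModuleCat.{0} R} (g : Y ⟶ Y') {n : ℕ} (x : oldExt n X Y) :
    theta (((Ext R (ModuleCat.{0} R) n).obj (op X)).map g x) =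
      (theta x).comp (Ext.mk₀ g) (add_zero n) := by
  obtain ⟨f, hf⟩ := rep_exists (projectiveResolution X) x
  rw [hf.theta, (hf.postcomp g).theta, ProjectiveResolution.extMk_comp_mk₀]

end bridge

section colim
open Opposite Limits CategoryTheory.Abelian
variable {R : Type} [CommRing R]

noncomputable def thetaE {X Y : ModuleCat.{0} R} (n : ℕ) : oldExt n X Y ≃ Ext X Y n :=
  Equiv.ofBijective theta ⟨fun _ _ h => theta_inj h, theta_surj⟩

abbrev lcQ (I : Ideal R) : ModuleCat.{0} R := ModuleCat.of R (R ⧸ I)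

/-- multiplication by `z` as a map `R/J → R/I`. -/
noncomputable def lcMul {J I : Ideal R} (z : R) (h : ∀ a ∈ J, z * a ∈ I) : lcQ J ⟶ lcQ I :=
  ModuleCat.ofHom (Submodule.mapQ J I (LinearMap.mulLeft R z) h)

noncomputable def lcPr {J I : Ideal R} (h : J ≤ I) : lcQ J ⟶ lcQ I :=
  ModuleCat.ofHom (Submodule.mapQ J I LinearMap.id h)

noncomputable abbrev lcD (a : Ideal R) (i : ℕ) :=
  localCohomology.diagram (localCohomology.idealPowersDiagram a) i

noncomputable def lcι (a : Ideal R) (i : ℕ) (M : ModuleCat.{0} R) (t : ℕ) :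
    oldExt i (lcQ (a ^ t)) M ⟶ (localCohomology a i).obj M :=
  (colimit.ι (lcD a i) (op (op t))).app M

noncomputable def lcCocone (a : Ideal R) (i : ℕ) (M : ModuleCat.{0} R) :=
  ((evaluation (ModuleCat.{0} R) (ModuleCat.{0} R)).obj M).mapCocone (colimit.cocone (lcD a i))

noncomputable def lcIsColim (a : Ideal R) (i : ℕ) (M : ModuleCat.{0} R) :
    IsColimit (lcCocone a i M) :=
  isColimitOfPreserves _ (colimit.isColimit (lcD a i))

lemma lcι_surj (a : Ideal R) (i : ℕ) (M : ModuleCat.{0} R) (x : (localCohomology a i).obj M) :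
    ∃ t y, lcι a i M t y = x := by
  obtain ⟨j, y, hy⟩ := Concrete.isColimit_exists_rep _ (lcIsColim a i M) x
  exact ⟨j.unop.unop, y, hy⟩

lemma lcι_trans (a : Ideal R) (i : ℕ) (M : ModuleCat.{0} R) {t s : ℕ} (h : t ≤ s)
    (y : oldExt i (lcQ (a ^ t)) M) :
    lcι a i M s (((Ext R (ModuleCat.{0} R) i).map (lcPr (Ideal.pow_le_pow_right h)).op).app M y)
      = lcι a i M t y := by
  have := congrArg (fun k => k.app M y) (colimit.w (lcD a i) (homOfLE h).op.op)
  exact this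

lemma lcι_zero (a : Ideal R) (i : ℕ) (M : ModuleCat.{0} R) {t : ℕ}
    (y : oldExt i (lcQ (a ^ t)) M) (hy : lcι a i M t y = 0) :
    ∃ (s : ℕ) (h : t ≤ s), ((Ext R (ModuleCat.{0} R) i).map
      (lcPr (Ideal.pow_le_pow_right (I := a) h)).op).app M y = 0 := by
  have h0 : (lcCocone a i M).ι.app (op (op t)) y = (lcCocone a i M).ι.app (op (op t)) 0 :=
    hy.trans (map_zero (lcι a i M t).hom).symm
  obtain ⟨k, f, g, h⟩ := Concrete.isColimit_exists_of_rep_eq _ (lcIsColim a i M) _ _ h0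
  have h2 := h.trans (map_zero (ModuleCat.Hom.hom _))
  exact ⟨k.unop.unop, leOfHom f.unop.unop, h2⟩

lemma lcι_map (a : Ideal R) (i : ℕ) {M N : ModuleCat.{0} R} (f : M ⟶ N) (t : ℕ)
    (y : oldExt i (lcQ (a ^ t)) M) :
    (localCohomology a i).map f (lcι a i M t y) =
      lcι a i N t (((Ext R (ModuleCat.{0} R) i).obj (op (lcQ (a ^ t)))).map f y) := by
  have := congrArg (fun k => k y) ((colimit.ι (lcD a i) (op (op t))).naturality f)
  exact this.symm

noncomputable def lcMk (a : Ideal R) (i : ℕ) (M : ModuleCat.{0} R) (t : ℕ)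
    (y : Ext (lcQ (a ^ t)) M i) : (localCohomology a i).obj M :=
  lcι a i M t ((thetaE i).symm y)

lemma lcMk_surj (a : Ideal R) (i : ℕ) (M : ModuleCat.{0} R) (x : (localCohomology a i).obj M) :
    ∃ t y, lcMk a i M t y = x := by
  obtain ⟨t, y, rfl⟩ := lcι_surj a i M x
  exact ⟨t, thetaE i y, by simp [lcMk]⟩

lemma lcMk_trans (a : Ideal R) (i : ℕ) (M : ModuleCat.{0} R) {t s : ℕ} (h : t ≤ s)
    (y : Ext (lcQ (a ^ t)) M i) :
    lcMk a i M s ((Ext.mk₀ (lcPr (Ideal.pow_le_pow_right h))).comp y (zero_add i))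
      = lcMk a i M t y := by
  obtain ⟨x, rfl⟩ := (thetaE i).surjective y
  unfold lcMk
  rw [Equiv.symm_apply_apply, ← lcι_trans a i M h]
  congr 1
  rw [Equiv.symm_apply_eq]
  exact (theta_precomp _ _).symm

lemma lcMk_zero' (a : Ideal R) (i : ℕ) (M : ModuleCat.{0} R) (t : ℕ) :
    lcMk a i M t 0 = 0 := by
  unfold lcMk
  have : (thetaE i).symm (0 : Ext (lcQ (a ^ t)) M i) = 0 := by
    rw [Equiv.symm_apply_eq]
    exact ((theta_eq_zero_iff _).2 rfl).symm
  rw [this, map_zero]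

lemma lcMk_zero_iff (a : Ideal R) (i : ℕ) (M : ModuleCat.{0} R) {t : ℕ}
    (y : Ext (lcQ (a ^ t)) M i) : lcMk a i M t y = 0 ↔
    ∃ (s : ℕ) (h : t ≤ s),
      (Ext.mk₀ (lcPr (Ideal.pow_le_pow_right (I := a) h))).comp y (zero_add i) = 0 := by
  constructor
  · intro hy
    obtain ⟨x, rfl⟩ := (thetaE i).surjective y
    unfold lcMk at hy
    rw [Equiv.symm_apply_apply] at hy
    obtain ⟨s, h, hs⟩ := lcι_zero a i M x hy
    exact ⟨s, h, (theta_precomp _ _).symm.trans ((theta_eq_zero_iff _).2 hs)⟩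
  · rintro ⟨s, h, hs⟩
    rw [← lcMk_trans a i M h, hs, lcMk_zero']

lemma lcMk_map (a : Ideal R) (i : ℕ) {M N : ModuleCat.{0} R} (f : M ⟶ N) (t : ℕ)
    (y : Ext (lcQ (a ^ t)) M i) :
    (localCohomology a i).map f (lcMk a i M t y) =
      lcMk a i N t (y.comp (Ext.mk₀ f) (add_zero i)) := by
  obtain ⟨x, rfl⟩ := (thetaE i).surjective y
  unfold lcMk
  rw [Equiv.symm_apply_apply, lcι_map]
  congr 1
  rw [eq_comm, Equiv.symm_apply_eq]
  exact (theta_postcomp _ _).symm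

/-- vanishing in elementary terms -/
def LCZero (a : Ideal R) (i : ℕ) (M : ModuleCat.{0} R) : Prop :=
  ∀ (t : ℕ) (y : Ext (lcQ (a ^ t)) M i), ∃ (s : ℕ) (h : t ≤ s),
      (Ext.mk₀ (lcPr (Ideal.pow_le_pow_right (I := a) h))).comp y (zero_add i) = 0

lemma lcZero_iff (a : Ideal R) (i : ℕ) (M : ModuleCat.{0} R) :
    LCZero a i M ↔ ¬ Nontrivial ((localCohomology a i).obj M) := by
  rw [not_nontrivial_iff_subsingleton]
  constructor
  · intro h
    refine subsingleton_of_forall_eq 0 fun x => ?_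
    obtain ⟨t, y, rfl⟩ := lcMk_surj a i M x
    exact (lcMk_zero_iff ..).2 (h t y)
  · intro h t y
    exact (lcMk_zero_iff ..).1 (Subsingleton.elim _ _)


lemma lc_f_inj {S : ShortComplex (ModuleCat.{0} R)} (hS : S.ShortExact) (a : Ideal R)
    {i j : ℕ} (hij : i + 1 = j) (h : LCZero a i S.X₃) :
    Function.Injective ((localCohomology a j).map S.f) := by
  rw [injective_iff_map_eq_zero]
  intro x hx
  obtain ⟨t, y, rfl⟩ := lcMk_surj a j _ x
  rw [lcMk_map, lcMk_zero_iff] at hx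
  obtain ⟨s, hs, h0⟩ := hx
  rw [← lcMk_trans a j _ hs]
  generalize hw : (Ext.mk₀ (lcPr (Ideal.pow_le_pow_right (I := a) hs))).comp y (zero_add j) = w
  have hw0 : w.comp (Ext.mk₀ S.f) (add_zero j) = 0 := by
    rw [← hw, ← h0]; exact Ext.comp_assoc _ _ _ _ _ (by simp)
  obtain ⟨v, rfl⟩ := Ext.covariant_sequence_exact₁ _ hS w hw0 hij
  obtain ⟨u, hu, hu0⟩ := h s v
  rw [lcMk_zero_iff]
  refine ⟨u, hu, ?_⟩
  rw [← Ext.comp_assoc _ _ _ (zero_add i) _ (by omega), hu0, Ext.zero_comp]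

lemma lc_f_surj {S : ShortComplex (ModuleCat.{0} R)} (hS : S.ShortExact) (a : Ideal R)
    {i : ℕ} (h : LCZero a i S.X₃) :
    Function.Surjective ((localCohomology a i).map S.f) := by
  intro x
  obtain ⟨t, y, rfl⟩ := lcMk_surj a i _ x
  obtain ⟨s, hs, h0⟩ := h t (y.comp (Ext.mk₀ S.g) (add_zero i))
  rw [← lcMk_trans a i _ hs]
  rw [← Ext.comp_assoc _ _ _ (zero_add i) _ (by omega)] at h0
  obtain ⟨v, hv⟩ := Ext.covariant_sequence_exact₂ _ hS _ h0
  exact ⟨lcMk a i _ s v, by rw [lcMk_map, hv]⟩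

lemma lc_g_inj {S : ShortComplex (ModuleCat.{0} R)} (hS : S.ShortExact) (a : Ideal R)
    {i : ℕ} (h : LCZero a i S.X₁) :
    Function.Injective ((localCohomology a i).map S.g) := by
  rw [injective_iff_map_eq_zero]
  intro x hx
  obtain ⟨t, y, rfl⟩ := lcMk_surj a i _ x
  rw [lcMk_map, lcMk_zero_iff] at hx
  obtain ⟨s, hs, h0⟩ := hx
  rw [← lcMk_trans a i _ hs]
  rw [← Ext.comp_assoc _ _ _ (zero_add i) _ (by omega)] at h0
  obtain ⟨v, hv⟩ := Ext.covariant_sequence_exact₂ _ hS _ h0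
  obtain ⟨u, hu, hu0⟩ := h s v
  rw [lcMk_zero_iff]
  refine ⟨u, hu, ?_⟩
  rw [← hv, ← Ext.comp_assoc _ _ _ (zero_add i) _ (by omega), hu0, Ext.zero_comp]

lemma lc_g_surj {S : ShortComplex (ModuleCat.{0} R)} (hS : S.ShortExact) (a : Ideal R)
    {i j : ℕ} (hij : i + 1 = j) (h : LCZero a j S.X₁) :
    Function.Surjective ((localCohomology a i).map S.g) := by
  intro x
  obtain ⟨t, y, rfl⟩ := lcMk_surj a i _ x
  obtain ⟨s, hs, h0⟩ := h t (y.comp hS.extClass hij)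
  rw [← lcMk_trans a i _ hs]
  rw [← Ext.comp_assoc _ _ _ (zero_add i) _ (by omega)] at h0
  obtain ⟨v, hv⟩ := Ext.covariant_sequence_exact₃ _ hS _ hij h0
  exact ⟨lcMk a i _ s v, by rw [lcMk_map, hv]⟩

end colim

section van
open Opposite Limits CategoryTheory.Abelian
variable {R : Type} [CommRing R]

lemma lcPr_comp {I J K : Ideal R} (h : I ≤ J) (h' : J ≤ K) :
    lcPr h ≫ lcPr h' = lcPr (h.trans h') := by
  ext x
  rfl

lemma lcMul_lcPr {I J K : Ideal R} (z : R) (h : ∀ a ∈ I, z * a ∈ J) (h' : J ≤ K) :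
    lcMul z h ≫ lcPr h' = lcMul z (fun a ha => h' (h a ha)) := by
  ext x
  rfl

lemma lcMul_comp_lcMul {I J K : Ideal R} (z z' w : R) (h : ∀ a ∈ I, z * a ∈ J)
    (h' : ∀ a ∈ J, z' * a ∈ K) (e : w = z' * z) :
    lcMul z h ≫ lcMul z' h' = lcMul w (fun a ha => by
      rw [e, mul_assoc]; exact h' _ (h a ha)) := by
  subst e
  ext x
  exact congrArg (Submodule.Quotient.mk (p := K)) (mul_assoc _ _ _).symm

lemma lcPr_comp_lcMul {I J K : Ideal R} (z : R) (h : I ≤ J) (h' : ∀ a ∈ J, z * a ∈ K) :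
    lcPr h ≫ lcMul z h' = lcMul z (fun a ha => h' a (h ha)) := by
  ext x
  rfl

lemma lc_ext_zero {S' S : ShortComplex (ModuleCat.{0} R)} (hS' : S'.ShortExact)
    (hS : S.ShortExact) (φ : S' ⟶ S) {M : ModuleCat.{0} R} {i : ℕ} (η : Ext S.X₁ M i)
    (h : (Ext.mk₀ φ.τ₁).comp η (zero_add _) = 0) :
    (Ext.mk₀ φ.τ₃).comp (hS.extClass.comp η rfl) (zero_add (1 + i)) = 0 := by
  have h7 := ShortComplex.ShortExact.extClass_naturality hS' hS φ
  rw [← Ext.comp_assoc _ _ _ (zero_add 1) _ (by omega), ← h7,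
    Ext.comp_assoc _ _ _ _ (zero_add i) (by omega), h, Ext.comp_zero]

abbrev lcColon (J : Ideal R) (y : R) : Ideal R := Submodule.comap (LinearMap.mulLeft R y) J

noncomputable abbrev lcS (J : Ideal R) (y : R) : ShortComplex (ModuleCat.{0} R) :=
  ShortComplex.mk (X₁ := lcQ (lcColon J y)) (X₂ := lcQ J) (X₃ := lcQ (J ⊔ Ideal.span {y}))
    (lcMul y (fun _ ha => ha)) (lcPr le_sup_left) (by
      ext x
      simp [lcMul, lcPr]
      refine (Submodule.Quotient.mk_eq_zero _).2 ?_
      exact Ideal.mem_sup_right (Ideal.mul_mem_right _ _ (Ideal.mem_span_singleton_self y)))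

lemma lcS_shortExact (J : Ideal R) (y : R) : (lcS J y).ShortExact := by
  apply ModuleCat.shortComplex_shortExact
  · intro u
    constructor
    · intro hu
      obtain ⟨u, rfl⟩ := Submodule.Quotient.mk_surjective _ u
      have h1 : u ∈ J ⊔ Ideal.span {y} := (Submodule.Quotient.mk_eq_zero _).1 hu
      obtain ⟨j, hj, z, hz, rfl⟩ := Submodule.mem_sup.1 h1
      obtain ⟨c, rfl⟩ := Ideal.mem_span_singleton.1 hz
      refine ⟨Submodule.Quotient.mk c, ?_⟩
      refine (Submodule.Quotient.eq _).2 ?_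
      simpa using hj
    · rintro ⟨v, rfl⟩
      exact congrArg (fun k => k v) (lcS J y).zero
  · refine (injective_iff_map_eq_zero _).2 ?_
    intro u hu
    obtain ⟨u, rfl⟩ := Submodule.Quotient.mk_surjective _ u
    have h1 : y * u ∈ J := (Submodule.Quotient.mk_eq_zero _).1 hu
    exact (Submodule.Quotient.mk_eq_zero _).2 h1
  · intro u
    obtain ⟨u, rfl⟩ := Submodule.Quotient.mk_surjective _ u
    exact ⟨Submodule.Quotient.mk u, rfl⟩

noncomputable def lcSMap {J' J : Ideal R} {y' y w : R} (hJ : J' ≤ J) (hy : y' = y * w)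
    (hL : J' ⊔ Ideal.span {y'} ≤ J ⊔ Ideal.span {y})
    (hw : ∀ a ∈ lcColon J' y', w * a ∈ lcColon J y) : lcS J' y' ⟶ lcS J y where
  τ₁ := lcMul w hw
  τ₂ := lcPr hJ
  τ₃ := lcPr hL
  comm₁₂ := by
    exact (lcMul_comp_lcMul _ _ _ hw _ hy).trans (lcMul_lcPr _ _ hJ).symm
  comm₂₃ := (lcPr_comp _ _).trans (lcPr_comp _ _).symm

def Van (b : Ideal R) (r : ℕ) : Prop := ∀ i, r < i → ∀ M : ModuleCat.{0} R, LCZero b i M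

lemma van_bot : Van (⊥ : Ideal R) 0 := by
  intro i hi M t y
  refine ⟨t + 1, by omega, ?_⟩
  have hp : Projective (lcQ ((⊥ : Ideal R) ^ (t + 1))) := by
    have : (⊥ : Ideal R) ^ (t + 1) = ⊥ := by
      rw [pow_succ]; simp
    rw [this]
    have : Module.Projective R (R ⧸ (⊥ : Ideal R)) :=
      Module.Projective.of_equiv (Submodule.quotEquivOfEqBot (⊥ : Ideal R) rfl).symm
    exact (IsProjective.iff_projective _).1 this
  obtain ⟨i, rfl⟩ : ∃ k, i = k + 1 := ⟨i - 1, by omega⟩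
  exact Ext.eq_zero_of_projective _

lemma van_step [IsNoetherianRing R] (b : Ideal R) (x : R) (r : ℕ) (hb : Van b r) :
    Van (b ⊔ Ideal.span {x}) (r + 1) := by
  intro i hi M t ξ
  obtain ⟨i, rfl⟩ : ∃ k, i = 1 + k := ⟨i - 1, by omega⟩
  have hLa : ∀ n t, t ≤ n → b ^ n ⊔ Ideal.span {x ^ n} ≤ (b ⊔ Ideal.span {x}) ^ t := by
    intro n t htn
    refine sup_le ((Ideal.pow_le_pow_right htn).trans (Ideal.pow_right_mono le_sup_left _)) ?_
    rw [← Ideal.span_singleton_pow]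
    exact (Ideal.pow_le_pow_right htn).trans (Ideal.pow_right_mono le_sup_right _)
  have hLL : ∀ m n, n ≤ m → b ^ m ⊔ Ideal.span {x ^ m} ≤ b ^ n ⊔ Ideal.span {x ^ n} := by
    intro m n h
    refine sup_le_sup (Ideal.pow_le_pow_right h) ?_
    rw [Ideal.span_singleton_le_span_singleton]
    exact pow_dvd_pow x h
  have hbt : b ^ t ≤ (b ⊔ Ideal.span {x}) ^ t := le_sup_left.trans (hLa t t le_rfl)
  obtain ⟨n, hn, h1⟩ := hb (1 + i) (by omega) M t ((Ext.mk₀ (lcPr hbt)).comp ξ (zero_add _))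
  let ξ1 := (Ext.mk₀ (lcPr (hLa n t hn))).comp ξ (zero_add _)
  have h2 : (Ext.mk₀ (lcS (b ^ n) (x ^ n)).g).comp ξ1 (zero_add _) = 0 := by
    have h1' : (Ext.mk₀ (lcPr (le_sup_left : b ^ n ≤ b ^ n ⊔ Ideal.span {x ^ n}))).comp ξ1
        (zero_add _) = 0 := by
      simp only [ξ1, Ext.mk₀_comp_mk₀_assoc, lcPr_comp] at h1 ⊢
      exact h1
    exact h1'
  obtain ⟨η, hη⟩ := Ext.contravariant_sequence_exact₃ (lcS_shortExact (b ^ n) (x ^ n)) M ξ1 h2 rfl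
  change Ext (lcQ (lcColon (b ^ n) (x ^ n))) M i at η
  have hcol : b ^ n ≤ lcColon (b ^ n) (x ^ n) := fun a ha => Ideal.mul_mem_left _ _ ha
  obtain ⟨n', hn', h3⟩ := hb i (by omega) M n
    ((Ext.mk₀ (lcPr hcol)).comp η (zero_add _))
  -- stabilisation
  obtain ⟨k, hk⟩ : ∃ k, ∀ m, k ≤ m → lcColon (b ^ n') (x ^ k) = lcColon (b ^ n') (x ^ m) := by
    refine monotone_stabilizes_iff_noetherian.2 (inferInstance : IsNoetherian R R)
      ⟨fun m => lcColon (b ^ n') (x ^ m), fun m m' h a ha => ?_⟩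
    change x ^ m' * a ∈ b ^ n'
    obtain ⟨d, rfl⟩ := Nat.exists_eq_add_of_le h
    rw [pow_add, mul_comm (x ^ m), mul_assoc]
    exact Ideal.mul_mem_left _ _ ha
  let m := n' + k
  have hnm : n ≤ m := by omega
  have hw' : ∀ a ∈ lcColon (b ^ m) (x ^ m), x ^ (m - n) * a ∈ b ^ n' := by
    intro a ha
    have h4 : a ∈ lcColon (b ^ n') (x ^ m) :=
      Ideal.pow_le_pow_right (I := b) (show n' ≤ m by omega) ha
    rw [← hk m (by omega), hk (m - n) (by omega)] at h4
    exact h4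
  have hw : ∀ a ∈ lcColon (b ^ m) (x ^ m), x ^ (m - n) * a ∈ lcColon (b ^ n) (x ^ n) :=
    fun a ha => hcol (Ideal.pow_le_pow_right hn' (hw' a ha))
  let φ : lcS (b ^ m) (x ^ m) ⟶ lcS (b ^ n) (x ^ n) :=
    lcSMap (Ideal.pow_le_pow_right hnm) (by rw [← pow_add]; congr 1; omega) (hLL m n hnm) hw
  have h5 : (Ext.mk₀ φ.τ₁).comp η (zero_add _) = 0 := by
    have h5' : (Ext.mk₀ (lcMul (x ^ (m - n)) hw)).comp η (zero_add _) = 0 := by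
      have h51 : lcMul (x ^ (m - n)) hw =
          lcMul _ hw' ≫ lcPr (Ideal.pow_le_pow_right hn') ≫ lcPr hcol := by
        rw [lcPr_comp, lcMul_lcPr]
      rw [h51, ← Ext.mk₀_comp_mk₀_assoc, ← Ext.mk₀_comp_mk₀_assoc, h3, Ext.comp_zero]
    exact h5'
  have h6 : (Ext.mk₀ (lcPr (hLL m n hnm))).comp ξ1 (zero_add _) = 0 := by
    have h6' := lc_ext_zero (lcS_shortExact (b ^ m) (x ^ m)) (lcS_shortExact (b ^ n) (x ^ n)) φ η h5
    exact (congrArg (fun u => (Ext.mk₀ (lcPr (hLL m n hnm))).comp u (zero_add _)) hη.symm).trans h6'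
  refine ⟨m + m, by omega, ?_⟩
  have hle : (b ⊔ Ideal.span {x}) ^ (m + m) ≤ b ^ m ⊔ Ideal.span {x ^ m} := by
    rw [← Ideal.span_singleton_pow]
    exact Ideal.sup_pow_add_le_pow_sup_pow
  have h8 := congrArg (fun u => (Ext.mk₀ (lcPr hle)).comp u (zero_add _)) h6
  simp only [Ext.comp_zero, ξ1, Ext.mk₀_comp_mk₀_assoc, lcPr_comp] at h8
  exact h8

lemma van_exists [IsNoetherianRing R] (a : Ideal R) : ∃ r, Van a r := by
  obtain ⟨s, rfl⟩ := (isNoetherianRing_iff_ideal_fg R).1 inferInstance a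
  classical
  induction s using Finset.induction_on with
  | empty => exact ⟨0, by simpa using van_bot⟩
  | insert x s _ ih =>
    obtain ⟨r, hr⟩ := ih
    refine ⟨r + 1, ?_⟩
    have := van_step _ x r hr
    rw [sup_comm] at this
    simpa [Submodule.span_insert, Ideal.span] using this

end van

section main
open Opposite Limits CategoryTheory.Abelian
variable {R : Type} [CommRing R]

lemma lcZero_of_cohDim [IsNoetherianRing R] (a : Ideal R) (N : Type) [AddCommGroup N] [Module R N]
    {k j : ℕ} (h : cohDim a N ≤ k) (hj : k < j) : LCZero a j (ModuleCat.of R N) := by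
  rw [lcZero_iff]
  intro hnt
  obtain ⟨r, hr⟩ := van_exists a
  have hb : BddAbove {i : ℕ | Nontrivial ((localCohomology a i).obj (ModuleCat.of R N))} := by
    refine ⟨r, fun i hi => ?_⟩
    by_contra hlt
    exact (lcZero_iff a i _).1 (hr i (by omega) _) hi
  have h2 : j ≤ cohDim a N := le_csSup hb hnt
  omega

lemma cohDim_congr (a : Ideal R) {N N' : Type} [AddCommGroup N] [Module R N]
    [AddCommGroup N'] [Module R N'] (e : N ≃ₗ[R] N') : cohDim a N = cohDim a N' := by
  unfold cohDim
  congr 1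
  ext i
  exact (((localCohomology a i).mapIso e.toModuleIso).toLinearEquiv).toEquiv.nontrivial_congr

lemma lcZero_of_subsingleton (a : Ideal R) (i : ℕ) (N : Type) [AddCommGroup N] [Module R N]
    [Subsingleton N] : LCZero a i (ModuleCat.of R N) := by
  intro t y
  refine ⟨t, le_rfl, ?_⟩
  have hz : 𝟙 (ModuleCat.of R N) = 0 := by
    ext x
    exact Subsingleton.elim _ _
  have hy : y = 0 := by
    rw [← Ext.comp_mk₀_id y, hz, Ext.mk₀_zero, Ext.comp_zero]
  rw [hy, Ext.comp_zero]

lemma lcZero_factor (a : Ideal R) (N : Type) [AddCommGroup N] [Module R N] (j k : ℕ)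
    (h : Subsingleton N ∨ (IsRelCM a N ∧ cohDim a N = j)) (hk : k ≠ j) :
    LCZero a k (ModuleCat.of R N) := by
  rcases h with h | ⟨⟨c, hc⟩, hj⟩
  · exact lcZero_of_subsingleton a k N
  · rw [lcZero_iff, hc]
    have : {i : ℕ | Nontrivial ((localCohomology a i).obj (ModuleCat.of R N))} = {c} := by
      ext i; simp [hc]
    unfold cohDim at hj
    rw [this, csSup_singleton] at hj
    omega

noncomputable abbrev filtS {M : Type} [AddCommGroup M] [Module R M] (F : ℕ → Submodule R M) (j : ℕ)
    (h : F (j - 1) ≤ F j) : ShortComplex (ModuleCat.{0} R) :=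
  ShortComplex.mk (X₁ := ModuleCat.of R ↥(F (j - 1))) (X₂ := ModuleCat.of R ↥(F j))
    (X₃ := ModuleCat.of R (filtFactor F j))
    (ModuleCat.ofHom (Submodule.inclusion h))
    (ModuleCat.ofHom (Submodule.mkQ (Submodule.comap (F j).subtype (F (j - 1))))) (by
      ext x
      exact (Submodule.Quotient.mk_eq_zero _).2 x.2)

lemma filtS_shortExact {M : Type} [AddCommGroup M] [Module R M] (F : ℕ → Submodule R M) (j : ℕ)
    (h : F (j - 1) ≤ F j) : (filtS F j h).ShortExact := by
  apply ModuleCat.shortComplex_shortExact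
  · intro u
    constructor
    · intro hu
      have h1 := (Submodule.Quotient.mk_eq_zero _).1 hu
      exact ⟨⟨u.1, h1⟩, rfl⟩
    · rintro ⟨v, rfl⟩
      exact (Submodule.Quotient.mk_eq_zero _).2 v.2
  · exact Submodule.inclusion_injective h
  · exact Submodule.mkQ_surjective _

end main

/-- Proposition 2.15: if `M` is RCMF w.r.t. `𝔞` with cd-filtration `{M_i}_{i=0}^c`, then
`H^i_𝔞(M) ≅ H^i_𝔞(M_i) ≅ H^i_𝔞(M_i/M_{i−1})` for all `1 ≤ i ≤ c`. -/
theorem stmt12 {R : Type} [CommRing R] [IsNoetherianRing R]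
    (𝔞 : Ideal R) (h𝔞 : 𝔞 ≠ ⊤)
    (M : Type) [AddCommGroup M] [Module R M] [Module.Finite R M]
    (hM : IsRCMF 𝔞 M)
    (c : ℕ) (hc : c = cohDim 𝔞 M)
    (F : ℕ → Submodule R M) (hF : IsCdFiltration 𝔞 c F)
    (i : ℕ) (hi1 : 1 ≤ i) (hic : i ≤ c) :
    Nonempty ((((localCohomology 𝔞 i).obj (ModuleCat.of R M)) ≃ₗ[R]
        ((localCohomology 𝔞 i).obj (ModuleCat.of R ↥(F i))))) ∧
      Nonempty ((((localCohomology 𝔞 i).obj (ModuleCat.of R ↥(F i))) ≃ₗ[R]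
        ((localCohomology 𝔞 i).obj (ModuleCat.of R (filtFactor F i))))) := by
  have hmono : ∀ j, 1 ≤ j → j ≤ c → F (j - 1) ≤ F j := fun j h1 h2 =>
    (hF j h2).2 _ ((hF (j - 1) (by omega)).1.trans (by omega))
  have hfac : ∀ j, 1 ≤ j → j ≤ c → ∀ k, k ≠ j → LCZero 𝔞 k (ModuleCat.of R (filtFactor F j)) :=
    fun j h1 h2 k hk => lcZero_factor 𝔞 _ j k (hM F (hc ▸ hF) j h1 (hc ▸ h2)) hk
  have htop : F c = ⊤ := top_le_iff.1 ((hF c le_rfl).2 ⊤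
    (by rw [cohDim_congr 𝔞 (Submodule.topEquiv : (⊤ : Submodule R M) ≃ₗ[R] M), hc]))
  have hstep : ∀ d, i + d ≤ c → Nonempty (((localCohomology 𝔞 i).obj (ModuleCat.of R ↥(F (i + d)))) ≃ₗ[R]
      ((localCohomology 𝔞 i).obj (ModuleCat.of R ↥(F i)))) := by
    intro d
    induction d with
    | zero => exact fun _ => ⟨LinearEquiv.refl R _⟩
    | succ d ih =>
      intro hd
      obtain ⟨e⟩ := ih (by omega)
      have hm := hmono (i + (d + 1)) (by omega) hd
      have hS := filtS_shortExact F (i + (d + 1)) hm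
      have hinj := lc_f_inj hS 𝔞 (i := i - 1) (j := i) (by omega)
        (hfac _ (by omega) hd _ (by omega))
      have hsurj := lc_f_surj hS 𝔞 (i := i) (hfac _ (by omega) hd _ (by omega))
      exact ⟨(LinearEquiv.ofBijective (ModuleCat.Hom.hom ((localCohomology 𝔞 i).map
        (filtS F (i + (d + 1)) hm).f)) ⟨hinj, hsurj⟩).symm.trans e⟩
  refine ⟨?_, ?_⟩
  · obtain ⟨e⟩ := hstep (c - i) (by omega)
    have hci : i + (c - i) = c := by omega
    rw [hci] at e
    let e0 : M ≃ₗ[R] ↥(F c) := (LinearEquiv.ofTop (F c) htop).symm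
    exact ⟨(((localCohomology 𝔞 i).mapIso e0.toModuleIso).toLinearEquiv).trans e⟩
  · have hm := hmono i hi1 hic
    have hS := filtS_shortExact F i hm
    have hcd := (hF (i - 1) (by omega)).1
    have hinj := lc_g_inj hS 𝔞 (i := i) (lcZero_of_cohDim 𝔞 _ hcd (by omega))
    have hsurj := lc_g_surj hS 𝔞 (i := i) rfl (lcZero_of_cohDim 𝔞 _ hcd (by omega))
    exact ⟨LinearEquiv.ofBijective (ModuleCat.Hom.hom ((localCohomology 𝔞 i).map
        (filtS F i hm).g)) ⟨hinj, hsurj⟩⟩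
end
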